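/- In the setting of the range equation (m, d ≥ 1; ω ∈ ℝ^d with ω·ν ≠ 0 for all nonzero ν ∈ ℤ^d; Γ symmetric positive definite; g = ∇V with V real analytic; f real analytic (2πℤ)^d-periodic with mean f₀; c with g(c) = f₀ and positive definite Hessian of V at c), the constants ε̄, ζ̄ > 0 and the solution family u(·, ε, ζ) of the range equation can be chosen so that, in addition, for every fixed ζ with |ζ| < ζ̄ the map ε ↦ u(·, ε, ζ), extended by u(·, 0, ζ) := 0, is continuous from [0, ε̄) into the space of bounded continuous functions ℝ^d → ℝ^m with the supremum norm; in particular sup_{ψ∈ℝ^d} |u(ψ, ε, ζ)| → 0 as ε → 0⁺. -/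

import Mathlib

open scoped Real BoundedContinuousFunction
open Filter

noncomputable section

/-- The mean of a `(2πℤ)^d`-periodic function over the fundamental box `[0,2π]^d`. -/
def boxMean (d m : ℕ) (F : (Fin d → ℝ) → (Fin m → ℝ)) : Fin m → ℝ :=
  ((2 * π)⁻¹ ^ d) • ∫ ψ in Set.univ.pi fun _ : Fin d => Set.Icc (0 : ℝ) (2 * π), F ψ

/-- `(2πℤ)^d`-periodicity. -/
def IsPeriodic2pi (d m : ℕ) (F : (Fin d → ℝ) → (Fin m → ℝ)) : Prop :=
  ∀ (ψ : Fin d → ℝ) (k : Fin d → ℤ), F (fun j => ψ j + 2 * π * k j) = F ψ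

/-- The Hessian matrix of `V : ℝ^m → ℝ` at the point `c`. -/
def hessianMatrix (m : ℕ) (V : (Fin m → ℝ) → ℝ) (c : Fin m → ℝ) :
    Matrix (Fin m) (Fin m) ℝ :=
  Matrix.of fun i j => iteratedFDeriv ℝ 2 V c ![Pi.single i 1, Pi.single j 1]

set_option linter.unusedSectionVars false

namespace RangeEq

/-- A strongly continuous one-parameter group of contractions (the translation flow). -/
structure IsFlow {X : Type*} [NormedAddCommGroup X] [NormedSpace ℝ X]
    (τ : ℝ → X →L[ℝ] X) : Prop where
  zero : τ 0 = 1
  add : ∀ s t, τ (s + t) = τ s * τ t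
  norm_le : ∀ t x, ‖τ t x‖ ≤ ‖x‖
  cont : ∀ x, Continuous fun t => τ t x

/-- Exponential decay of the semigroup generated by `-M`. -/
def Decays {X : Type*} [NormedAddCommGroup X] [NormedSpace ℝ X] (M : X →L[ℝ] X)
    (C α : ℝ) : Prop :=
  0 < α ∧ 0 ≤ C ∧ ∀ s : ℝ, 0 ≤ s → ‖NormedSpace.exp ((-s) • M)‖ ≤ C * Real.exp (-(α * s))

section Abstract

variable {X : Type*} [NormedAddCommGroup X] [NormedSpace ℝ X] [CompleteSpace X]

lemma exp_smul_continuous (M : X →L[ℝ] X) :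
    Continuous fun s : ℝ => NormedSpace.exp ((-s) • M) := by
  have : ∀ s : ℝ, HasDerivAt (fun s : ℝ => NormedSpace.exp (s • M))
    (NormedSpace.exp (s • M) * M) s := fun s => hasDerivAt_exp_smul_const M s
  have h : Continuous (fun s : ℝ => NormedSpace.exp (s • M)) :=
    continuous_iff_continuousAt.2 fun s => (this s).continuousAt
  exact h.comp continuous_neg

/-- The integrand of the resolvent. -/
def resInt (τ : ℝ → X →L[ℝ] X) (M : X →L[ℝ] X) (l : ℝ) (x : X) (s : ℝ) : X :=
  NormedSpace.exp ((-s) • M) (τ (-(s / l)) x)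

lemma IsFlow.cont_uncurry {τ : ℝ → X →L[ℝ] X} (h : IsFlow τ) :
    Continuous fun p : ℝ × X => τ p.1 p.2 := by
  rw [continuous_iff_continuousAt]
  rintro ⟨t, x⟩
  rw [ContinuousAt, tendsto_iff_norm_sub_tendsto_zero]
  have h1 : Tendsto (fun p : ℝ × X => ‖p.2 - x‖ + ‖τ p.1 x - τ t x‖) (nhds (t, x)) (nhds 0) := by
    have : Continuous (fun p : ℝ × X => ‖p.2 - x‖ + ‖τ p.1 x - τ t x‖) := by
      have := (h.cont x).comp (continuous_fst (X := ℝ) (Y := X))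
      exact ((continuous_snd.sub continuous_const).norm).add ((this.sub continuous_const).norm)
    simpa using this.tendsto (t, x)
  refine squeeze_zero (fun _ => norm_nonneg _) (fun p => ?_) h1
  have : τ p.1 p.2 - τ t x = τ p.1 (p.2 - x) + (τ p.1 x - τ t x) := by
    rw [map_sub]; abel
  rw [this]
  refine (norm_add_le _ _).trans ?_
  gcongr
  exact h.norm_le _ _

lemma resInt_cont {τ : ℝ → X →L[ℝ] X} (h : IsFlow τ) (M : X →L[ℝ] X) (l : ℝ) (x : X) :
    Continuous (resInt τ M l x) := by
  unfold resInt
  have h1 := exp_smul_continuous M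
  have h2 : Continuous fun s : ℝ => τ (-(s / l)) x := (h.cont x).comp (by fun_prop)
  exact h1.clm_apply h2

lemma resInt_norm {τ : ℝ → X →L[ℝ] X} (h : IsFlow τ) {M : X →L[ℝ] X} {C α : ℝ}
    (hM : Decays M C α) (l : ℝ) (x : X) {s : ℝ} (hs : 0 ≤ s) :
    ‖resInt τ M l x s‖ ≤ C * Real.exp (-(α * s)) * ‖x‖ := by
  unfold resInt
  refine (ContinuousLinearMap.le_opNorm _ _).trans ?_
  have := hM.2.1
  gcongr
  · exact hM.2.2 s hs
  · exact h.norm_le _ _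

lemma bound_integrable (C : ℝ) {α : ℝ} (hα : 0 < α) (c : ℝ) :
    MeasureTheory.IntegrableOn (fun s => C * Real.exp (-(α * s)) * c) (Set.Ioi 0) := by
  have := (exp_neg_integrableOn_Ioi 0 hα)
  simp only [neg_mul] at this
  exact (this.const_mul C).mul_const c

lemma resInt_integrable {τ : ℝ → X →L[ℝ] X} (h : IsFlow τ) {M : X →L[ℝ] X} {C α : ℝ}
    (hM : Decays M C α) (l : ℝ) (x : X) :
    MeasureTheory.IntegrableOn (resInt τ M l x) (Set.Ioi 0) := by
  refine MeasureTheory.Integrable.mono' (bound_integrable C hM.1 ‖x‖)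
    (resInt_cont h M l x).aestronglyMeasurable ?_
  filter_upwards [MeasureTheory.ae_restrict_mem measurableSet_Ioi] with s hs
  exact resInt_norm h hM l x (le_of_lt hs)

lemma bound_integral (C : ℝ) {α : ℝ} (hα : 0 < α) (c : ℝ) :
    ∫ s in Set.Ioi (0 : ℝ), C * Real.exp (-(α * s)) * c = C / α * c := by
  rw [MeasureTheory.integral_mul_const, MeasureTheory.integral_const_mul]
  have := integral_exp_mul_Ioi (a := -α) (by linarith) 0
  simp only [neg_mul] at this
  rw [this]; simp; left; ring

lemma resInt_integral_norm {τ : ℝ → X →L[ℝ] X} (h : IsFlow τ) {M : X →L[ℝ] X} {C α : ℝ}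
    (hM : Decays M C α) (l : ℝ) (x : X) :
    ‖∫ s in Set.Ioi (0 : ℝ), resInt τ M l x s‖ ≤ C / α * ‖x‖ := by
  rw [← bound_integral C hM.1]
  refine MeasureTheory.norm_integral_le_of_norm_le (bound_integrable C hM.1 ‖x‖) ?_
  filter_upwards [MeasureTheory.ae_restrict_mem measurableSet_Ioi] with s hs
  exact resInt_norm h hM l x (le_of_lt hs)

/-- The resolvent `(D/l + M)⁻¹`. -/
def res {τ : ℝ → X →L[ℝ] X} (h : IsFlow τ) {M : X →L[ℝ] X} {C α : ℝ}
    (hM : Decays M C α) (l : ℝ) : X →L[ℝ] X :=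
  LinearMap.mkContinuous
    { toFun := fun x => ∫ s in Set.Ioi (0 : ℝ), resInt τ M l x s
      map_add' := fun x y => by
        rw [← MeasureTheory.integral_add (resInt_integrable h hM l x) (resInt_integrable h hM l y)]
        simp [resInt]
      map_smul' := fun c x => by
        rw [RingHom.id_apply, ← MeasureTheory.integral_smul]
        simp [resInt] } (C / α) (fun x => resInt_integral_norm h hM l x)

lemma res_apply {τ : ℝ → X →L[ℝ] X} (h : IsFlow τ) {M : X →L[ℝ] X} {C α : ℝ}
    (hM : Decays M C α) (l : ℝ) (x : X) :
    res h hM l x = ∫ s in Set.Ioi (0 : ℝ), resInt τ M l x s := rfl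

lemma res_norm {τ : ℝ → X →L[ℝ] X} (h : IsFlow τ) {M : X →L[ℝ] X} {C α : ℝ}
    (hM : Decays M C α) (l : ℝ) : ‖res h hM l‖ ≤ C / α :=
  LinearMap.mkContinuous_norm_le _ (div_nonneg hM.2.1 hM.1.le) _

lemma res_commute {τ : ℝ → X →L[ℝ] X} (h : IsFlow τ) {M : X →L[ℝ] X} {C α : ℝ}
    (hM : Decays M C α) (l : ℝ) {B : X →L[ℝ] X} (hB : ∀ t, Commute B (τ t)) (hBM : Commute B M) :
    Commute B (res h hM l) := by
  ext x
  change B (res h hM l x) = res h hM l (B x)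
  rw [res_apply, res_apply, ← ContinuousLinearMap.integral_comp_comm _ (resInt_integrable h hM l x)]
  congr 1
  ext s
  have h1 : Commute B (NormedSpace.exp ((-s) • M)) := (hBM.smul_right (-s)).exp_right
  have h2 := congrArg (fun T : X →L[ℝ] X => T (τ (-(s / l)) x)) h1.eq
  have h3 := congrArg (fun T : X →L[ℝ] X => T x) (hB (-(s / l))).eq
  simp only [mul_apply_eq_comp] at h2 h3
  simp only [resInt, h2, h3]

lemma res_cont {τ : ℝ → X →L[ℝ] X} (h : IsFlow τ) {M : X →L[ℝ] X} {C α : ℝ}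
    (hM : Decays M C α) (x : X) : ContinuousOn (fun l => res h hM l x) (Set.Ioi 0) := by
  intro l hl
  refine ContinuousAt.continuousWithinAt ?_
  simp only [res_apply]
  refine MeasureTheory.continuousAt_of_dominated (bound := fun s => C * Real.exp (-(α * s)) * ‖x‖)
    ?_ ?_ (bound_integrable C hM.1 ‖x‖) ?_
  · exact Eventually.of_forall fun l => (resInt_cont h M l x).aestronglyMeasurable
  · refine Eventually.of_forall fun l => ?_
    filter_upwards [MeasureTheory.ae_restrict_mem measurableSet_Ioi] with s hs
    exact resInt_norm h hM l x (le_of_lt hs)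
  · refine Eventually.of_forall fun s => ?_
    unfold resInt
    have h1 : ContinuousAt (fun l : ℝ => -(s / l)) l :=
      (continuousAt_const.div continuousAt_id (ne_of_gt hl)).neg
    have h2 : ContinuousAt (fun l : ℝ => τ (-(s / l)) x) l :=
      ContinuousAt.comp (g := fun t => τ t x) (h.cont x).continuousAt h1
    exact (ContinuousLinearMap.continuous _).continuousAt.comp h2

lemma res_deriv {τ : ℝ → X →L[ℝ] X} (h : IsFlow τ) {M : X →L[ℝ] X} {C α : ℝ}
    (hM : Decays M C α) (hMτ : ∀ t, Commute M (τ t)) {l : ℝ} (hl : 0 < l) (x : X) :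
    HasDerivAt (fun t => τ t (res h hM l x)) (l • (x - M (res h hM l x))) 0 := by
  -- rewrite the flow of the resolvent
  let W : ℝ → X := fun r => NormedSpace.exp (r • M) (τ (r / l) x)
  have hexp : ∀ a b : ℝ, NormedSpace.exp ((a + b) • M)
      = NormedSpace.exp (a • M) * NormedSpace.exp (b • M) := by
    intro a b
    letI : NormedAlgebra ℚ (X →L[ℝ] X) := NormedAlgebra.restrictScalars ℚ ℝ _
    rw [add_smul, NormedSpace.exp_add_of_commute]
    exact ((Commute.refl M).smul_left a).smul_right b
  have hWc : Continuous W := by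
    have h1 := (exp_smul_continuous M).comp continuous_neg
    have h2 : Continuous fun s : ℝ => τ (s / l) x := (h.cont x).comp (by fun_prop)
    simpa [Function.comp_def] using h1.clm_apply h2
  have hWint : MeasureTheory.IntegrableOn W (Set.Iic 0) := by
    have h1 := resInt_integrable h hM l x
    rw [← integrableOn_Ici_iff_integrableOn_Ioi] at h1
    have := h1.comp_neg
    simpa [W, resInt, Function.comp_def, neg_div] using this
  have hkey : ∀ t : ℝ, τ t (res h hM l x)
      = NormedSpace.exp ((-(l * t)) • M) (∫ r in Set.Iic (l * t), W r) := by
    intro t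
    rw [res_apply, ← ContinuousLinearMap.integral_comp_comm _ (resInt_integrable h hM l x)]
    have h1 : ∀ s, τ t (resInt τ M l x s) = NormedSpace.exp ((-(l * t)) • M) (W (l * t - s)) := by
      intro s
      have hc : Commute (τ t) (NormedSpace.exp ((-s) • M)) := ((hMτ t).symm.smul_right (-s)).exp_right
      have h2 := congrArg (fun T : X →L[ℝ] X => T (τ (-(s / l)) x)) hc.eq
      simp only [mul_apply_eq_comp] at h2
      have h3 : NormedSpace.exp ((-s) • M) = NormedSpace.exp ((-(l * t)) • M) *
        NormedSpace.exp ((l * t - s) • M) := by rw [← hexp]; congr 2; ring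
      have h4 : τ ((l * t - s) / l) = τ t * τ (-(s / l)) := by
        rw [← h.add]; congr 1; field_simp; ring
      simp only [resInt, W, h2]
      simp only [h3, h4, mul_apply_eq_comp]
    simp only [h1]
    have hIntble : MeasureTheory.IntegrableOn W (Set.Iic (l * t)) := by
      rcases le_total (l * t) 0 with h0 | h0
      · exact hWint.mono_set (Set.Iic_subset_Iic.2 h0)
      · rw [← Set.Iic_union_Icc_eq_Iic h0]
        exact hWint.union (hWc.continuousOn.integrableOn_Icc)
    have hsub : ∫ s in Set.Ioi (0:ℝ), W (l * t - s) = ∫ r in Set.Iic (l * t), W r := by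
      have := integral_comp_neg_Ioi (c := 0) (fun s => W (l * t + s))
      simp only [← sub_eq_add_neg, neg_zero] at this
      rw [this]
      have h5 := MeasureTheory.integral_add_left_eq_self (μ := MeasureTheory.volume)
        ((Set.Iic (l * t)).indicator W) (l * t)
      rw [MeasureTheory.integral_indicator measurableSet_Iic] at h5
      rw [← h5, ← MeasureTheory.integral_indicator measurableSet_Iic]
      congr 1
      ext s
      simp [Set.indicator]
    rw [← hsub]
    refine ContinuousLinearMap.integral_comp_comm _ ?_
    change MeasureTheory.IntegrableOn (fun s => W (l * t - s)) (Set.Ioi 0)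
    rw [← integrableOn_Ici_iff_integrableOn_Ioi]
    have h6 : MeasureTheory.IntegrableOn (fun s => W (l * t + s)) (Set.Iic 0) := by
      rw [← MeasureTheory.integrable_indicator_iff measurableSet_Iic] at hIntble ⊢
      have := hIntble.comp_add_left (l * t)
      refine this.congr (Eventually.of_forall fun s => ?_)
      simp [Set.indicator]
    have := h6.comp_neg
    simpa [← sub_eq_add_neg] using this
  have hd1 : HasDerivAt (fun t : ℝ => NormedSpace.exp ((-(l * t)) • M)) (-(l • M)) 0 := by
    have h1 := hasDerivAt_exp_smul_const (𝕂 := ℝ) M (-(l * 0))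
    have h2 : HasDerivAt (fun t : ℝ => -(l * t)) (-(l * 1)) 0 := ((hasDerivAt_id 0).const_mul l).neg
    have := HasDerivAt.scomp (0:ℝ) h1 h2
    simpa [Function.comp_def] using this
  have hd2 : HasDerivAt (fun t : ℝ => ∫ r in Set.Iic (l * t), W r) (l • x) 0 := by
    have h1 : ∀ b, ∫ r in Set.Iic b, W r = (∫ r in Set.Iic 0, W r) + ∫ r in (0:ℝ)..b, W r := by
      intro b
      have hIntble : ∀ b, MeasureTheory.IntegrableOn W (Set.Iic b) := by
        intro b
        rcases le_total b 0 with h0 | h0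
        · exact hWint.mono_set (Set.Iic_subset_Iic.2 h0)
        · rw [← Set.Iic_union_Icc_eq_Iic h0]
          exact hWint.union (hWc.continuousOn.integrableOn_Icc)
      rw [← intervalIntegral.integral_Iic_sub_Iic (hIntble 0) (hIntble b)]
      abel
    have h2 : HasDerivAt (fun b : ℝ => ∫ r in Set.Iic b, W r) (W (l * 0)) (l * 0) := by
      rw [funext h1]
      exact (hWc.integral_hasStrictDerivAt 0 (l * 0)).hasDerivAt.const_add _
    have h3 : HasDerivAt (fun t : ℝ => (l * t)) (l * 1) 0 := ((hasDerivAt_id 0).const_mul l)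
    have := HasDerivAt.scomp (0:ℝ) h2 h3
    simpa [Function.comp_def, W, h.zero] using this
  have hd := hd1.clm_apply hd2
  have h0 := hkey 0
  simp only [h.zero, mul_zero, neg_zero, zero_smul, NormedSpace.exp_zero,
    one_apply_eq_self] at h0
  simp only [← hkey] at hd
  convert hd using 1
  simp only [mul_zero, neg_zero, zero_smul, NormedSpace.exp_zero, ← h0]
  simp [smul_sub]
  abel

end Abstract
end RangeEq

namespace RangeEq

section Abstract2

variable {X : Type*} [NormedAddCommGroup X] [NormedSpace ℝ X] [CompleteSpace X]

lemma strong_apply {s : Set ℝ} {A : ℝ → X →L[ℝ] X} {v : ℝ → X} {C : ℝ}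
    (hA : ∀ e ∈ s, ‖A e‖ ≤ C) (hAc : ∀ x, ContinuousOn (fun e => A e x) s)
    (hv : ContinuousOn v s) : ContinuousOn (fun e => A e (v e)) s := by
  intro e he
  rw [ContinuousWithinAt, tendsto_iff_norm_sub_tendsto_zero]
  have h1 : Tendsto (fun e' => C * ‖v e' - v e‖ + ‖A e' (v e) - A e (v e)‖) (nhdsWithin e s)
      (nhds (C * ‖v e - v e‖ + ‖A e (v e) - A e (v e)‖)) :=
    (((hv e he).sub tendsto_const_nhds).norm.const_mul C).add
      (((hAc (v e)) e he).sub tendsto_const_nhds).norm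
  simp only [sub_self, norm_zero, mul_zero, add_zero] at h1
  refine squeeze_zero' (Eventually.of_forall fun _ => norm_nonneg _) ?_ h1
  filter_upwards [self_mem_nhdsWithin] with e' he'
  have : A e' (v e') - A e (v e) = A e' (v e' - v e) + (A e' (v e) - A e (v e)) := by
    rw [map_sub]; abel
  rw [this]
  refine (norm_add_le _ _).trans ?_
  gcongr
  exact (A e').le_of_opNorm_le (hA e' he') _

/-- The uniformly bounded solution operator of `ε D² y + Γ D y + ε Γ S y = ε h`. -/
theorem exists_solution_operator {τ : ℝ → X →L[ℝ] X} (h : IsFlow τ) {G S : X →L[ℝ] X}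
    {C₁ α₁ C₂ α₂ : ℝ} (hG : Decays G C₁ α₁) (hS : Decays S C₂ α₂)
    (hGτ : ∀ t, Commute G (τ t)) (hSτ : ∀ t, Commute S (τ t)) :
    ∃ ε₀ > (0 : ℝ), ∃ C > (0 : ℝ), ∃ K : ℝ → X →L[ℝ] X,
      (∀ ε ∈ Set.Ioo 0 ε₀, ‖K ε‖ ≤ C) ∧
      (∀ ε ∈ Set.Ioo 0 ε₀, ∀ B : X →L[ℝ] X, Commute B G → Commute B S →
        (∀ t, Commute B (τ t)) → Commute B (K ε)) ∧
      (∀ x, ContinuousOn (fun ε => K ε x) (Set.Ioo 0 ε₀)) ∧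
      (∀ ε ∈ Set.Ioo 0 ε₀, ∀ x, ∃ q, ‖q‖ ≤ C * ‖x‖ ∧
        HasDerivAt (fun t => τ t (K ε x)) (ε • (q - S (K ε x))) 0 ∧
        HasDerivAt (fun t => τ t (ε • (q - S (K ε x)))) (x - G q) 0) := by
  set c₁ := C₁ / α₁ with hc₁
  set c₂ := C₂ / α₂ with hc₂
  have hc₁0 : 0 ≤ c₁ := div_nonneg hG.2.1 hG.1.le
  have hc₂0 : 0 ≤ c₂ := div_nonneg hS.2.1 hS.1.le
  let R1 : ℝ → X →L[ℝ] X := fun ε => res h hG ε⁻¹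
  let R2 : ℝ → X →L[ℝ] X := fun ε => res h hS ε
  have hR1 : ∀ ε, ‖R1 ε‖ ≤ c₁ := fun ε => res_norm h hG _
  have hR2 : ∀ ε, ‖R2 ε‖ ≤ c₂ := fun ε => res_norm h hS _
  let Z : ℝ → X →L[ℝ] X := fun ε => (ε ^ 2) • (R1 ε * (S * (1 - S * R2 ε)))
  set c₀ := c₁ * (‖S‖ * (1 + ‖S‖ * c₂)) with hc₀
  have hc₀0 : 0 ≤ c₀ := by positivity
  have hone : ‖(1 : X →L[ℝ] X)‖ ≤ 1 := ContinuousLinearMap.norm_id_le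
  have hZ : ∀ ε, ‖Z ε‖ ≤ ε ^ 2 * c₀ := by
    intro ε
    simp only [Z]
    rw [norm_smul, Real.norm_eq_abs, abs_of_nonneg (sq_nonneg ε)]
    gcongr
    rw [hc₀]
    refine (norm_mul_le _ _).trans ?_
    gcongr
    · exact hR1 ε
    refine (norm_mul_le _ _).trans ?_
    gcongr
    refine (norm_sub_le _ _).trans (add_le_add hone ?_)
    refine (norm_mul_le _ _).trans ?_
    gcongr
    exact hR2 ε
  set ε₀ : ℝ := 1 / (2 * c₀ + 1) with hε₀
  have hε₀0 : 0 < ε₀ := by positivity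
  have hZhalf : ∀ ε ∈ Set.Ioo 0 ε₀, ‖Z ε‖ ≤ 1 / 2 := by
    intro ε hε
    refine (hZ ε).trans ?_
    have h1 : ε * (2 * c₀ + 1) < 1 := by
      have := hε.2
      rw [hε₀, lt_div_iff₀ (by positivity)] at this
      exact this
    have h0 := hε.1
    have h2 : ε < 1 := by nlinarith
    nlinarith [mul_nonneg h0.le hc₀0, mul_nonneg (mul_nonneg h0.le hc₀0) (sub_nonneg.2 h2.le)]
  let J : ℝ → X →L[ℝ] X := fun ε => Ring.inverse (1 - Z ε)
  have hunit : ∀ ε ∈ Set.Ioo 0 ε₀, IsUnit (1 - Z ε) := fun ε hε =>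
    isUnit_one_sub_of_norm_lt_one (lt_of_le_of_lt (hZhalf ε hε) (by norm_num))
  have hJ1 : ∀ ε ∈ Set.Ioo 0 ε₀, (1 - Z ε) * J ε = 1 := fun ε hε =>
    Ring.mul_inverse_cancel _ (hunit ε hε)
  have hJ2 : ∀ ε ∈ Set.Ioo 0 ε₀, J ε * (1 - Z ε) = 1 := fun ε hε =>
    Ring.inverse_mul_cancel _ (hunit ε hε)
  have hlow : ∀ ε ∈ Set.Ioo 0 ε₀, ∀ x, ‖x‖ ≤ 2 * ‖(1 - Z ε) x‖ := by
    intro ε hε x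
    have h1 : ‖Z ε x‖ ≤ 1 / 2 * ‖x‖ := (Z ε).le_of_opNorm_le (hZhalf ε hε) x
    have h2 : x = (1 - Z ε) x + Z ε x := by simp
    have h3 : ‖x‖ ≤ ‖(1 - Z ε) x‖ + ‖Z ε x‖ := by
      conv_lhs => rw [h2]
      exact norm_add_le _ _
    linarith
  have hJa : ∀ ε ∈ Set.Ioo 0 ε₀, ∀ x, (1 - Z ε) (J ε x) = x := fun ε hε x => by
    have := congrArg (fun T : X →L[ℝ] X => T x) (hJ1 ε hε)
    simpa only [mul_apply_eq_comp, one_apply_eq_self] using this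
  have hJn : ∀ ε ∈ Set.Ioo 0 ε₀, ∀ x, ‖J ε x‖ ≤ 2 * ‖x‖ := by
    intro ε hε x
    have := hlow ε hε (J ε x)
    rwa [hJa ε hε x] at this
  have hqn : ∀ ε ∈ Set.Ioo 0 ε₀, ∀ x, ‖J ε (R1 ε x)‖ ≤ 2 * c₁ * ‖x‖ := by
    intro ε hε x
    refine (hJn ε hε _).trans ?_
    rw [mul_assoc]
    gcongr
    exact (R1 ε).le_of_opNorm_le (hR1 ε) x
  have hR1c : ∀ x, ContinuousOn (fun ε => R1 ε x) (Set.Ioo 0 ε₀) := by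
    intro x
    refine ContinuousOn.comp (g := fun l => res h hG l x) (t := Set.Ioi 0) (res_cont h hG x)
      (f := fun ε : ℝ => ε⁻¹) ?_ ?_
    · exact continuousOn_id.inv₀ fun ε hε => ne_of_gt hε.1
    · intro ε hε; exact inv_pos.2 hε.1
  have hR2c : ∀ x, ContinuousOn (fun ε => R2 ε x) (Set.Ioo 0 ε₀) := fun x =>
    (res_cont h hS x).mono fun ε hε => hε.1
  have hZc : ∀ x, ContinuousOn (fun ε => Z ε x) (Set.Ioo 0 ε₀) := by
    intro x
    have h1 : ContinuousOn (fun ε => S (x - S (R2 ε x))) (Set.Ioo 0 ε₀) :=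
      S.continuous.comp_continuousOn (continuousOn_const.sub (S.continuous.comp_continuousOn (hR2c x)))
    have h2 := strong_apply (fun e _ => hR1 e) hR1c h1
    have h3 : ContinuousOn (fun ε : ℝ => ε ^ 2) (Set.Ioo 0 ε₀) := by fun_prop
    exact h3.smul h2
  have hJc : ∀ x, ContinuousOn (fun ε => J ε x) (Set.Ioo 0 ε₀) := by
    intro x e he
    rw [ContinuousWithinAt, tendsto_iff_norm_sub_tendsto_zero]
    have h1 : Tendsto (fun e' => 2 * ‖Z e' (J e x) - Z e (J e x)‖) (nhdsWithin e (Set.Ioo 0 ε₀))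
        (nhds (2 * ‖Z e (J e x) - Z e (J e x)‖)) :=
      ((hZc (J e x) e he).sub tendsto_const_nhds).norm.const_mul 2
    simp only [sub_self, norm_zero, mul_zero] at h1
    refine squeeze_zero' (Eventually.of_forall fun _ => norm_nonneg _) ?_ h1
    filter_upwards [self_mem_nhdsWithin] with e' he'
    refine (hlow e' he' _).trans (le_of_eq ?_)
    congr 2
    rw [map_sub, hJa e' he']
    have h3 := hJa e he x
    simp only [sub_apply, one_apply_eq_self] at h3 ⊢
    generalize J e x = v at h3 ⊢
    rw [← h3]
    abel
  refine ⟨ε₀, hε₀0, c₂ * (2 * c₁) + 2 * c₁ + 1, by positivity,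
    fun ε => R2 ε * (J ε * R1 ε), ?_, ?_, ?_, ?_⟩
  · intro ε hε
    refine ContinuousLinearMap.opNorm_le_bound _ (by positivity) fun x => ?_
    simp only [mul_apply_eq_comp]
    refine ((R2 ε).le_of_opNorm_le (hR2 ε) _).trans ?_
    have := hqn ε hε x
    calc c₂ * ‖J ε (R1 ε x)‖ ≤ c₂ * (2 * c₁ * ‖x‖) := by gcongr
      _ ≤ _ := by nlinarith [norm_nonneg x, mul_nonneg hc₁0 (norm_nonneg x)]
  · intro ε hε B hBG hBS hBτ
    have b1 : Commute B (R1 ε) := res_commute h hG _ hBτ hBG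
    have b2 : Commute B (R2 ε) := res_commute h hS _ hBτ hBS
    have bZ : Commute B (1 - Z ε) := by
      refine (Commute.one_right B).sub_right (Commute.smul_right ?_ _)
      exact b1.mul_right (hBS.mul_right ((Commute.one_right B).sub_right (hBS.mul_right b2)))
    have bJ : Commute B (J ε) := by
      have e1 : B * J ε = J ε * (1 - Z ε) * (B * J ε) := by rw [hJ2 ε hε, one_mul]
      have e2 : J ε * (1 - Z ε) * (B * J ε) = J ε * B * ((1 - Z ε) * J ε) := by
        rw [mul_assoc, ← mul_assoc (1 - Z ε), ← bZ.eq]; simp only [mul_assoc]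
      rw [Commute, SemiconjBy, e1, e2, hJ1 ε hε, mul_one]
    exact b2.mul_right (bJ.mul_right b1)
  · intro x
    have h1 : ContinuousOn (fun ε => J ε (R1 ε x)) (Set.Ioo 0 ε₀) :=
      strong_apply (C := 2) (fun e he => ContinuousLinearMap.opNorm_le_bound _ (by norm_num)
        (hJn e he)) hJc (hR1c x)
    exact strong_apply (A := R2) (fun e _ => hR2 e) hR2c h1
  · intro ε hε x
    have hε0 := hε.1
    set q := J ε (R1 ε x) with hq
    set y := R2 ε q with hy
    have hq1 : q = R1 ε (x + (ε ^ 2) • S (q - S y)) := by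
      have := hJa ε hε (R1 ε x)
      rw [← hq] at this
      simp only [sub_apply, one_apply_eq_self, Z, smul_apply, mul_apply_eq_comp] at this
      rw [sub_eq_iff_eq_add] at this
      conv_lhs => rw [this]
      rw [map_add, map_smul, hy]
    have hdy : HasDerivAt (fun t => τ t y) (ε • (q - S y)) 0 := res_deriv h hS hSτ hε0 q
    have hdq : HasDerivAt (fun t => τ t q) (ε⁻¹ • (x + (ε ^ 2) • S (q - S y) - G q)) 0 := by
      have := res_deriv h hG hGτ (inv_pos.2 hε0) (x + (ε ^ 2) • S (q - S y))
      change HasDerivAt (fun t => τ t (R1 ε _)) (ε⁻¹ • (_ - G (R1 ε _))) 0 at this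
      rwa [← hq1] at this
    refine ⟨q, ?_, hdy, ?_⟩
    · refine (hqn ε hε x).trans ?_
      have : 0 ≤ c₂ * (2 * c₁) := by positivity
      nlinarith [norm_nonneg x, mul_nonneg this (norm_nonneg x)]
    · have hSy : HasDerivAt (fun t => τ t (S y)) (S (ε • (q - S y))) 0 := by
        have h1 := S.hasFDerivAt.comp_hasDerivAt (0:ℝ) hdy
        refine h1.congr_of_eventuallyEq (Eventually.of_forall fun t => ?_)
        have := congrArg (fun T : X →L[ℝ] X => T y) (hSτ t).eq
        simp only [mul_apply_eq_comp] at this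
        exact this.symm
      have h1 := (hdq.sub hSy).const_smul ε
      convert h1 using 1
      · ext t; simp [map_smul, map_sub]; rfl
      · have hne : ε ≠ 0 := hε0.ne'
        simp only [smul_sub, smul_add, smul_smul, map_sub, map_smul]
        rw [mul_inv_cancel₀ hne]
        have : ε * (ε⁻¹ * ε ^ 2) = ε * ε := by field_simp
        rw [this]
        simp only [one_smul]
        abel

/-- Vectors that are reversed by the flow at some time are damped by the solution operator. -/
lemma flow_reversed_small {τ : ℝ → X →L[ℝ] X} (h : IsFlow τ) {y w : X}
    (hd : HasDerivAt (fun t => τ t y) w 0) {T : ℝ} (hT : τ T y = -y) :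
    2 * ‖y‖ ≤ ‖w‖ * |T| := by
  have hd' : ∀ t, HasDerivAt (fun t => τ t y) (τ t w) t := by
    intro t
    have h1 : HasDerivAt (fun s : ℝ => s - t) 1 t := by
      simpa using (hasDerivAt_id t).sub_const t
    have h0 : HasDerivAt (fun t => τ t y) w (t - t) := by simpa using hd
    have h2 := HasDerivAt.scomp (h := fun s : ℝ => s - t) t h0 h1
    have h3 := (τ t).hasFDerivAt.comp_hasDerivAt t h2
    simp only [one_smul] at h3
    refine h3.congr_of_eventuallyEq (Eventually.of_forall fun s => ?_)
    simp only [Function.comp_def]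
    rw [← mul_apply_eq_comp, ← h.add]
    congr 2; ring
  have := Convex.norm_image_sub_le_of_norm_hasDerivWithin_le (f := fun t => τ t y)
    (f' := fun t => τ t w) (s := Set.univ) (C := ‖w‖) (x := 0) (y := T)
    (fun t _ => (hd' t).hasDerivWithinAt) (fun t _ => h.norm_le t w) convex_univ
    (Set.mem_univ _) (Set.mem_univ _)
  simp only [hT, h.zero, one_apply_eq_self, sub_zero, Real.norm_eq_abs] at this
  have e : -y - y = -((2:ℝ) • y) := by rw [two_smul]; abel
  rw [e, norm_neg, norm_smul] at this
  simpa using this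

end Abstract2
end RangeEq

namespace RangeEq

section Decay

open Matrix

/-- multiplication by a matrix as a continuous linear map. -/
def mv {m : ℕ} (M : Matrix (Fin m) (Fin m) ℝ) : (Fin m → ℝ) →L[ℝ] (Fin m → ℝ) :=
  LinearMap.toContinuousLinearMap (Matrix.mulVecLin M)

@[simp] lemma mv_apply {m : ℕ} (M : Matrix (Fin m) (Fin m) ℝ) (x : Fin m → ℝ) :
    mv M x = M *ᵥ x := rfl

lemma quad_bounds {m : ℕ} {B : Matrix (Fin m) (Fin m) ℝ} (hB : B.PosDef) :
    ∃ β > (0 : ℝ), ∃ γ > (0 : ℝ), ∀ x : Fin m → ℝ,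
      β * ‖x‖ ^ 2 ≤ x ⬝ᵥ B *ᵥ x ∧ x ⬝ᵥ B *ᵥ x ≤ γ * ‖x‖ ^ 2 := by
  let φ : (Fin m → ℝ) → ℝ := fun x => x ⬝ᵥ B *ᵥ x
  have hφ : Continuous φ := by
    have : Continuous fun x : Fin m → ℝ => B *ᵥ x := (mv B).continuous
    exact continuous_id.dotProduct this
  have hpos : ∀ x, x ≠ 0 → 0 < φ x := fun x hx => by
    have := hB.dotProduct_mulVec_pos hx
    simpa using this
  have hhom : ∀ (a : ℝ) x, φ (a • x) = a ^ 2 * φ x := fun a x => by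
    simp only [φ, mulVec_smul, dotProduct_smul, smul_dotProduct, smul_eq_mul]; ring
  have hc : IsCompact (Metric.sphere (0 : Fin m → ℝ) 1) := isCompact_sphere _ _
  have key : ∃ β > (0 : ℝ), ∃ γ > (0 : ℝ), ∀ x ∈ Metric.sphere (0 : Fin m → ℝ) 1,
      β ≤ φ x ∧ φ x ≤ γ := by
    rcases (Metric.sphere (0 : Fin m → ℝ) 1).eq_empty_or_nonempty with h | h
    · exact ⟨1, one_pos, 1, one_pos, by simp [h]⟩
    · obtain ⟨a, ha, hamin⟩ := hc.exists_isMinOn h hφ.continuousOn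
      obtain ⟨b, hb, hbmax⟩ := hc.exists_isMaxOn h hφ.continuousOn
      have hne : ∀ x ∈ Metric.sphere (0 : Fin m → ℝ) 1, x ≠ 0 := by
        rintro x hx rfl
        simp at hx
      exact ⟨φ a, hpos a (hne a ha), φ b, hpos b (hne b hb), fun x hx => ⟨hamin hx, hbmax hx⟩⟩
  obtain ⟨β, hβ, γ, hγ, hk⟩ := key
  refine ⟨β, hβ, γ, hγ, fun x => ?_⟩
  change β * ‖x‖ ^ 2 ≤ φ x ∧ φ x ≤ γ * ‖x‖ ^ 2
  by_cases hx : x = 0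
  · subst hx; simp [φ]
  have hn : ‖x‖ ≠ 0 := norm_ne_zero_iff.2 hx
  have hu : ‖x‖⁻¹ • x ∈ Metric.sphere (0 : Fin m → ℝ) 1 := by
    simp [norm_smul, hn]
  have hxx : φ x = ‖x‖ ^ 2 * φ (‖x‖⁻¹ • x) := by
    rw [hhom]; field_simp
  rw [hxx]
  have := hk _ hu
  have h2 : 0 ≤ ‖x‖ ^ 2 := by positivity
  constructor <;> nlinarith [this.1, this.2]

lemma matrix_decay {m : ℕ} {G M : Matrix (Fin m) (Fin m) ℝ} (hG : G.PosDef)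
    (hGM : (G * M).PosDef) : ∃ C α, Decays (mv M) C α := by
  obtain ⟨β, hβ, γ, hγ, h1⟩ := quad_bounds hG
  obtain ⟨β', hβ', γ', hγ', h2⟩ := quad_bounds hGM
  set α := β' / γ with hα
  have hα0 : 0 < α := by positivity
  refine ⟨Real.sqrt (γ / β), α, hα0, Real.sqrt_nonneg _, fun s hs => ?_⟩
  refine ContinuousLinearMap.opNorm_le_bound _ (by positivity) fun x => ?_
  let v : ℝ → (Fin m → ℝ) := fun s => NormedSpace.exp ((-s) • mv M) x
  have hv : ∀ s, HasDerivAt v (-(M *ᵥ v s)) s := by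
    intro s
    have e1 := hasDerivAt_exp_smul_const' (𝕂 := ℝ) (mv M) (-s)
    have e2 := HasDerivAt.scomp (h := fun s : ℝ => -s) s e1 (hasDerivAt_neg s)
    have e3 := e2.clm_apply (hasDerivAt_const s x)
    have e4 : HasDerivAt v _ s := e3
    convert e4 using 1
    simp [v, -neg_smul]
    exact (neg_one_smul ℝ _).symm
  let φ : ℝ → ℝ := fun s => v s ⬝ᵥ G *ᵥ v s
  have hGv : ∀ s, HasDerivAt (fun s => G *ᵥ v s) (G *ᵥ (-(M *ᵥ v s))) s := fun s =>
    (mv G).hasFDerivAt.comp_hasDerivAt s (hv s)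
  have hsym : Gᵀ = G := by
    have := hG.isHermitian
    simpa [Matrix.IsHermitian] using this
  have hφ : ∀ s, HasDerivAt φ (-2 * (v s ⬝ᵥ (G * M) *ᵥ v s)) s := by
    intro s
    have e1 : HasDerivAt (fun s => ∑ i, v s i * (G *ᵥ v s) i)
        (∑ i, ((-(M *ᵥ v s)) i * (G *ᵥ v s) i + v s i * (G *ᵥ (-(M *ᵥ v s))) i)) s := by
      refine HasDerivAt.fun_sum fun i _ => ?_
      exact (hasDerivAt_pi.1 (hv s) i).mul (hasDerivAt_pi.1 (hGv s) i)
    have e0 : HasDerivAt φ _ s := e1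
    convert e0 using 1
    rw [Finset.sum_add_distrib]
    change _ = (-(M *ᵥ v s)) ⬝ᵥ (G *ᵥ v s) + v s ⬝ᵥ (G *ᵥ (-(M *ᵥ v s)))
    have e2 : (M *ᵥ v s) ⬝ᵥ (G *ᵥ v s) = v s ⬝ᵥ (G * M) *ᵥ v s := by
      rw [dotProduct_mulVec, ← mulVec_transpose, hsym, dotProduct_comm, mulVec_mulVec]
    rw [neg_dotProduct, mulVec_neg, dotProduct_neg, e2, mulVec_mulVec]
    ring
  let Φ : ℝ → ℝ := fun s => Real.exp (2 * α * s) * φ s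
  have hΦ : ∀ s, HasDerivAt Φ (Real.exp (2 * α * s) * (2 * α) * φ s
      + Real.exp (2 * α * s) * (-2 * (v s ⬝ᵥ (G * M) *ᵥ v s))) s := by
    intro s
    have e1 : HasDerivAt (fun s => Real.exp (2 * α * s)) (Real.exp (2 * α * s) * (2 * α)) s := by
      have := ((hasDerivAt_id s).const_mul (2 * α)).exp
      simpa using this
    exact e1.mul (hφ s)
  have hanti : Antitone Φ := by
    refine antitone_of_hasDerivAt_nonpos hΦ (fun s => ?_)
    have e1 := (h1 (v s)).2
    have e2 := (h2 (v s)).1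
    have e3 : α * φ s ≤ v s ⬝ᵥ (G * M) *ᵥ v s := by
      calc α * φ s ≤ α * (γ * ‖v s‖ ^ 2) := by gcongr
        _ = β' * ‖v s‖ ^ 2 := by rw [hα]; field_simp
        _ ≤ _ := e2
    have e4 := Real.exp_pos (2 * α * s)
    have e5 := mul_le_mul_of_nonneg_left e3 e4.le
    change _ ≤ (0 : ℝ)
    linarith
  have h0 := hanti hs
  have hΦ0 : Φ 0 ≤ γ * ‖x‖ ^ 2 := by
    have := (h1 x).2
    simpa [Φ, φ, v] using this
  have hfin : β * ‖v s‖ ^ 2 * Real.exp (2 * α * s) ≤ γ * ‖x‖ ^ 2 := by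
    have e1 := (h1 (v s)).1
    have e4 := Real.exp_pos (2 * α * s)
    calc β * ‖v s‖ ^ 2 * Real.exp (2 * α * s) ≤ φ s * Real.exp (2 * α * s) := by gcongr
      _ = Φ s := by simp [Φ]; ring
      _ ≤ _ := h0.trans hΦ0
  change ‖v s‖ ≤ _
  refine le_of_sq_le_sq ?_ (by positivity)
  rw [mul_pow, mul_pow, Real.sq_sqrt (by positivity), ← Real.exp_nat_mul]
  have e5 : Real.exp (2 * α * s) * Real.exp (((2:ℕ):ℝ) * -(α * s)) = 1 := by
    rw [← Real.exp_add]; simp; ring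
  have e6 := Real.exp_pos (((2:ℕ):ℝ) * -(α * s))
  have := mul_le_mul_of_nonneg_right hfin e6.le
  rw [mul_assoc, e5, mul_one] at this
  rw [div_mul_eq_mul_div, div_mul_eq_mul_div, le_div_iff₀ hβ]
  linarith

variable {Y : Type*} [TopologicalSpace Y] [CompactSpace Y]
variable {E : Type*} [NormedAddCommGroup E] [NormedSpace ℝ E]

/-- pointwise application of a continuous linear map. -/
def post (Y : Type*) [TopologicalSpace Y] [CompactSpace Y] {E : Type*} [NormedAddCommGroup E]
    [NormedSpace ℝ E] (A : E →L[ℝ] E) : C(Y, E) →L[ℝ] C(Y, E) :=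
  A.compLeftContinuous ℝ Y

@[simp] lemma post_apply (A : E →L[ℝ] E) (u : C(Y, E)) (y : Y) : post Y A u y = A (u y) := rfl

lemma post_norm (A : E →L[ℝ] E) : ‖post Y A‖ ≤ ‖A‖ := by
  refine ContinuousLinearMap.opNorm_le_bound _ (norm_nonneg _) fun u => ?_
  rw [ContinuousMap.norm_le _ (by positivity)]
  intro y
  exact (A.le_opNorm _).trans (by gcongr; exact u.norm_coe_le_norm y)

/-- `post` as a ring homomorphism. -/
def postHom (Y : Type*) [TopologicalSpace Y] [CompactSpace Y] (E : Type*) [NormedAddCommGroup E]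
    [NormedSpace ℝ E] : (E →L[ℝ] E) →+* (C(Y, E) →L[ℝ] C(Y, E)) where
  toFun := post Y
  map_one' := rfl
  map_mul' _ _ := rfl
  map_zero' := rfl
  map_add' _ _ := rfl

lemma postHom_continuous : Continuous (postHom Y E) :=
  AddMonoidHomClass.continuous_of_bound (postHom Y E) 1 fun A => by
    rw [one_mul]; exact post_norm A

lemma post_exp [CompleteSpace E] (A : E →L[ℝ] E) :
    NormedSpace.exp (post Y A) = post Y (NormedSpace.exp A) := by
  let _ : NormedAlgebra ℚ (E →L[ℝ] E) := NormedAlgebra.restrictScalars ℚ ℝ _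
  let _ : NormedAlgebra ℚ (C(Y, E) →L[ℝ] C(Y, E)) := NormedAlgebra.restrictScalars ℚ ℝ _
  exact (NormedSpace.map_exp (postHom Y E) postHom_continuous A).symm

lemma post_decays [CompleteSpace E] {A : E →L[ℝ] E} {C α : ℝ} (h : Decays A C α) :
    Decays (post Y A) C α := by
  refine ⟨h.1, h.2.1, fun s hs => ?_⟩
  have : (-s) • post Y A = post Y ((-s) • A) := rfl
  rw [this, post_exp]
  exact (post_norm _).trans (h.2.2 s hs)

end Decay
end RangeEq

namespace RangeEq

section Nemytskii

variable {Y : Type*} [TopologicalSpace Y] [CompactSpace Y]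
variable {E F : Type*} [NormedAddCommGroup E] [NormedSpace ℝ E]
  [NormedAddCommGroup F] [NormedSpace ℝ F]

/-- pointwise application of a continuous family of multilinear maps. -/
def liftML {n : ℕ} (G : C(Y, E [×n]→L[ℝ] F)) : C(Y, E) [×n]→L[ℝ] C(Y, F) :=
  MultilinearMap.mkContinuous
    { toFun := fun v => ⟨fun y => G y (fun i => v i y), by
        refine Continuous.eval G.continuous (continuous_pi fun i => (v i).continuous)⟩
      map_update_add' := fun v i a b => by
        ext y
        have : ∀ c : C(Y, E), (fun j => Function.update v i c j y)
            = Function.update (fun j => v j y) i (c y) := fun c => by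
          ext j; exact Function.apply_update (fun _ (w : C(Y, E)) => w y) v i c j
        simp [this]
      map_update_smul' := fun v i a b => by
        ext y
        have : ∀ c : C(Y, E), (fun j => Function.update v i c j y)
            = Function.update (fun j => v j y) i (c y) := fun c => by
          ext j; exact Function.apply_update (fun _ (w : C(Y, E)) => w y) v i c j
        simp [this] } ‖G‖ (fun v => by
          rw [ContinuousMap.norm_le _ (by positivity)]
          intro y
          refine ((G y).le_opNorm _).trans ?_
          have h1 := G.norm_coe_le_norm y
          have h2 : ∏ i, ‖v i y‖ ≤ ∏ i, ‖v i‖ :=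
            Finset.prod_le_prod (fun _ _ => norm_nonneg _) fun i _ => (v i).norm_coe_le_norm y
          gcongr)

lemma liftML_apply {n : ℕ} (G : C(Y, E [×n]→L[ℝ] F)) (v : Fin n → C(Y, E)) (y : Y) :
    liftML G v y = G y (fun i => v i y) := rfl

lemma liftML_norm {n : ℕ} (G : C(Y, E [×n]→L[ℝ] F)) : ‖liftML G‖ ≤ ‖G‖ :=
  MultilinearMap.mkContinuous_norm_le _ (norm_nonneg G) _

theorem hasFPowerSeries_lift [CompleteSpace F] (P : ∀ n, C(Y, E [×n]→L[ℝ] F)) {C a r : ℝ}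
    (ha : 0 < a) (hP : ∀ n, ‖P n‖ ≤ C * a ^ n) (hr : 0 < r) (hra : r * a ≤ 1)
    (Φ : C(Y, E) → C(Y, F))
    (hΦ : ∀ v : C(Y, E), ‖v‖ < r → ∀ y, HasSum (fun n => P n y (fun _ => v y)) (Φ v y)) :
    HasFPowerSeriesOnBall Φ (fun n => liftML (P n)) 0 (ENNReal.ofReal r) where
  r_le := by
    have := FormalMultilinearSeries.le_radius_of_bound (fun n => liftML (P n)) C
      (r := r.toNNReal) (fun n => by
        rw [Real.coe_toNNReal _ hr.le]
        have hC : 0 ≤ C := by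
          have := (norm_nonneg (P 0)).trans (hP 0)
          simpa using this
        calc ‖liftML (P n)‖ * r ^ n ≤ (C * a ^ n) * r ^ n := by
              gcongr; exact (liftML_norm _).trans (hP n)
          _ = C * (r * a) ^ n := by rw [mul_pow]; ring
          _ ≤ C * 1 := by gcongr; exact pow_le_one₀ (by positivity) hra
          _ = C := mul_one _)
    exact this
  r_pos := by simpa using hr
  hasSum := by
    intro v hv
    have hv' : ‖v‖ < r := by
      simpa [Metric.mem_eball, edist_zero_right, ← ofReal_norm, ENNReal.ofReal_lt_ofReal_iff hr]
        using hv
    rw [zero_add]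
    have hC : 0 ≤ C := by
      have := (norm_nonneg (P 0)).trans (hP 0)
      simpa using this
    have hlt : a * ‖v‖ < 1 := by nlinarith
    have hs : Summable fun n => liftML (P n) (fun _ => v) := by
      refine Summable.of_norm_bounded (g := fun n => C * (a * ‖v‖) ^ n)
        ((summable_geometric_of_lt_one (by positivity) hlt).mul_left C) fun n => ?_
      refine ((liftML (P n)).le_opNorm _).trans ?_
      rw [Finset.prod_const, Finset.card_univ, Fintype.card_fin, mul_pow, ← mul_assoc]
      gcongr
      exact (liftML_norm _).trans (hP n)
    have hE : Φ v = ∑' n, liftML (P n) (fun _ => v) := by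
      ext1 y
      have h1 := (ContinuousMap.evalCLM ℝ y : C(Y, F) →L[ℝ] F).hasSum hs.hasSum
      exact ((hΦ v hv' y).unique h1)
    rw [hE]
    exact hs.hasSum

/-- The substitution operator of an analytic function near a constant. -/
theorem nemytskii_analytic [CompleteSpace F] {g : E → F} {c : E} (hg : AnalyticAt ℝ g c)
    (hgc : Continuous g) :
    ∃ r > (0 : ℝ), ∀ v : C(Y, E), ‖v‖ < r →
      AnalyticAt ℝ (fun v : C(Y, E) => (⟨fun y => g (c + v y), by fun_prop⟩ : C(Y, F))) v := by
  obtain ⟨p, R, hp⟩ := hg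
  obtain ⟨ρ, hρ0, hρR⟩ := ENNReal.lt_iff_exists_nnreal_btwn.1 hp.r_pos
  have hρ0' : 0 < (ρ : ℝ) := by exact_mod_cast hρ0
  obtain ⟨C, hC, hCp⟩ := p.norm_mul_pow_le_of_lt_radius (lt_of_lt_of_le hρR hp.r_le)
  have hps := hasFPowerSeries_lift (Y := Y) (fun n => ContinuousMap.const Y (p n)) (C := C)
    (a := (ρ : ℝ)⁻¹) (r := ρ) (by positivity) (fun n => by
      rw [ContinuousMap.norm_le _ (by positivity)]
      intro y
      have := hCp n
      rw [inv_pow, ← div_eq_mul_inv, le_div_iff₀ (by positivity)]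
      exact this) hρ0' (by rw [mul_inv_cancel₀ hρ0'.ne'])
    (fun v : C(Y, E) => (⟨fun y => g (c + v y), by fun_prop⟩ : C(Y, F))) (fun v hv y => by
      refine hp.hasSum ?_
      have h1 : ‖v y‖ < ρ := lt_of_le_of_lt (v.norm_coe_le_norm y) hv
      rw [Metric.mem_eball, edist_zero_right]
      refine lt_trans ?_ hρR
      rw [enorm_eq_nnnorm]
      exact_mod_cast h1)
  refine ⟨ρ, hρ0', fun v hv => ?_⟩
  refine hps.analyticAt_of_mem ?_
  rw [Metric.mem_eball, edist_zero_right, ← ofReal_norm]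
  exact (ENNReal.ofReal_lt_ofReal_iff hρ0').2 hv

lemma changeOrigin_bound (p : FormalMultilinearSeries ℝ E F) {ρ : NNReal}
    (h : ((ρ : ENNReal) + ρ) < p.radius) :
    ∃ T : ℝ, 0 ≤ T ∧ ∀ y : E, ‖y‖ ≤ ρ → ∀ k, ‖p.changeOrigin y k‖ * (ρ : ℝ) ^ k ≤ T := by
  have hs := p.changeOriginSeries_summable_aux₁ h
  refine ⟨((∑' s : Σ k l : ℕ, { s : Finset (Fin (k + l)) // s.card = l },
      ‖p (s.1 + s.2.1)‖₊ * ρ ^ s.2.1 * ρ ^ s.1 : NNReal) : ℝ), NNReal.coe_nonneg _,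
      fun y hy k => ?_⟩
  have hρ : (ρ : ENNReal) < p.radius := lt_of_le_of_lt (le_add_right le_rfl) h
  have hy' : ‖y‖₊ ≤ ρ := hy
  have h1 := p.nnnorm_changeOrigin_le (x := y) k
    (lt_of_le_of_lt (by exact_mod_cast hy') hρ)
  have h2 : ∑' s : Σ l : ℕ, { s : Finset (Fin (k + l)) // s.card = l }, ‖p (k + s.1)‖₊ * ‖y‖₊ ^ s.1
      ≤ ∑' s : Σ l : ℕ, { s : Finset (Fin (k + l)) // s.card = l }, ‖p (k + s.1)‖₊ * ρ ^ s.1 := by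
    have hsum := p.changeOriginSeries_summable_aux₂ hρ k
    have hle : ∀ s : Σ l : ℕ, { s : Finset (Fin (k + l)) // s.card = l },
        ‖p (k + s.1)‖₊ * ‖y‖₊ ^ s.1 ≤ ‖p (k + s.1)‖₊ * ρ ^ s.1 := fun s => by gcongr
    exact (NNReal.summable_of_le hle hsum).tsum_le_tsum hle hsum
  have h3 := NNReal.tsum_comp_le_tsum_of_inj hs
    (i := fun s : Σ l : ℕ, { s : Finset (Fin (k + l)) // s.card = l } => ⟨k, s⟩)
    (fun a b hab => eq_of_heq (Sigma.mk.inj hab).2)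
  have h4 : ‖p.changeOrigin y k‖₊ * ρ ^ k ≤
      ∑' s : Σ l : ℕ, { s : Finset (Fin (k + l)) // s.card = l },
        ‖p (k + s.1)‖₊ * ρ ^ s.1 * ρ ^ k := by
    rw [NNReal.tsum_mul_right]
    gcongr
    exact h1.trans h2
  exact_mod_cast h4.trans h3

/-- uniform bounds for Taylor coefficients on compact sets. -/
theorem uniform_taylor [CompleteSpace F] {f : E → F} (hf : AnalyticOnNhd ℝ f Set.univ)
    {K : Set E} (hK : IsCompact K) :
    ∃ C a r : ℝ, 0 ≤ C ∧ 0 < a ∧ 0 < r ∧ ∀ x ∈ K,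
      (∀ n : ℕ, ‖((n.factorial : ℝ)⁻¹) • iteratedFDeriv ℝ n f x‖ ≤ C * a ^ n) ∧
      ∀ v : E, ‖v‖ < r →
        HasSum (fun n : ℕ => ((n.factorial : ℝ)⁻¹ • iteratedFDeriv ℝ n f x) fun _ => v)
          (f (x + v)) := by
  refine hK.induction_on (p := fun K => ∃ C a r : ℝ, 0 ≤ C ∧ 0 < a ∧ 0 < r ∧ ∀ x ∈ K,
      (∀ n : ℕ, ‖((n.factorial : ℝ)⁻¹) • iteratedFDeriv ℝ n f x‖ ≤ C * a ^ n) ∧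
      ∀ v : E, ‖v‖ < r →
        HasSum (fun n : ℕ => ((n.factorial : ℝ)⁻¹ • iteratedFDeriv ℝ n f x) fun _ => v)
          (f (x + v))) ?_ ?_ ?_ ?_
  · exact ⟨1, 1, 1, by norm_num, by norm_num, by norm_num, by simp⟩
  · rintro s t hst ⟨C, a, r, hC, ha, hr, h⟩
    exact ⟨C, a, r, hC, ha, hr, fun x hx => h x (hst hx)⟩
  · rintro s t ⟨C, a, r, hC, ha, hr, h⟩ ⟨C', a', r', hC', ha', hr', h'⟩
    refine ⟨max C C', max a a', min r r', le_max_of_le_left hC, lt_max_of_lt_left ha,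
      lt_min hr hr', ?_⟩
    rintro x (hx | hx)
    · refine ⟨fun n => ((h x hx).1 n).trans ?_, fun v hv =>
        (h x hx).2 v (hv.trans_le (min_le_left _ _))⟩
      gcongr <;> exact le_max_left _ _
    · refine ⟨fun n => ((h' x hx).1 n).trans ?_, fun v hv =>
        (h' x hx).2 v (hv.trans_le (min_le_right _ _))⟩
      gcongr <;> exact le_max_right _ _
  · intro x₀ _
    obtain ⟨p, R, hp⟩ := hf x₀ (Set.mem_univ _)
    obtain ⟨ρ₂, hρ0, hρR⟩ := ENNReal.lt_iff_exists_nnreal_btwn.1 hp.r_pos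
    set ρ := ρ₂ / 2 with hρ
    have hρ2 : (ρ : ENNReal) + ρ = ρ₂ := by
      rw [← ENNReal.coe_add, hρ, add_halves]
    have hρpos : 0 < ρ := by
      have : 0 < ρ₂ := by exact_mod_cast hρ0
      positivity
    have hρpos' : 0 < (ρ : ℝ) := by exact_mod_cast hρpos
    obtain ⟨T, hT, hb⟩ := changeOrigin_bound p (ρ := ρ)
      (by rw [hρ2]; exact hρR.trans_le hp.r_le)
    refine ⟨Metric.ball x₀ ρ, mem_nhdsWithin_of_mem_nhds (Metric.ball_mem_nhds _ hρpos'),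
      T, (ρ : ℝ)⁻¹, ρ, hT, by positivity, hρpos', fun x hx => ?_⟩
    have hy : ‖x - x₀‖ < ρ := by simpa [dist_eq_norm] using hx
    have hyR : (‖x - x₀‖₊ : ENNReal) < R := by
      refine lt_of_le_of_lt ?_ (lt_of_le_of_lt (le_add_right le_rfl) (hρ2 ▸ hρR : (ρ:ENNReal) + ρ < R))
      exact_mod_cast hy.le
    have hx' := hp.changeOrigin hyR
    rw [add_sub_cancel] at hx'
    constructor
    · intro n
      have hfac : (0:ℝ) < n.factorial := by exact_mod_cast n.factorial_pos
      have h1 : ‖iteratedFDeriv ℝ n f x‖ ≤ n.factorial * ‖p.changeOrigin (x - x₀) n‖ := by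
        refine ContinuousMultilinearMap.opNorm_le_bound (by positivity) fun v => ?_
        rw [hx'.iteratedFDeriv_eq_sum hf.analyticOn]
        refine (norm_sum_le _ _).trans ?_
        have : ∀ σ ∈ (Finset.univ : Finset (Equiv.Perm (Fin n))),
            ‖p.changeOrigin (x - x₀) n (fun i => v (σ i))‖
            ≤ ‖p.changeOrigin (x - x₀) n‖ * ∏ i, ‖v i‖ := by
          intro σ _
          refine (ContinuousMultilinearMap.le_opNorm _ _).trans (le_of_eq ?_)
          congr 1
          exact Equiv.prod_comp σ fun i => ‖v i‖
        refine (Finset.sum_le_card_nsmul _ _ _ this).trans (le_of_eq ?_)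
        rw [Finset.card_univ, Fintype.card_perm, Fintype.card_fin, nsmul_eq_mul, mul_assoc]
      rw [norm_smul, norm_inv, Real.norm_of_nonneg hfac.le]
      have h2 := hb (x - x₀) hy.le n
      calc (n.factorial : ℝ)⁻¹ * ‖iteratedFDeriv ℝ n f x‖
          ≤ (n.factorial : ℝ)⁻¹ * (n.factorial * ‖p.changeOrigin (x - x₀) n‖) := by gcongr
        _ = ‖p.changeOrigin (x - x₀) n‖ := by field_simp
        _ ≤ T * (ρ : ℝ)⁻¹ ^ n := by
          rw [inv_pow, ← div_eq_mul_inv, le_div_iff₀ (by positivity)]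
          exact h2
    · intro v hv
      have hmem : v ∈ Metric.eball (0 : E) (R - ‖x - x₀‖₊) := by
        rw [Metric.mem_eball, edist_zero_right, enorm_eq_nnnorm]
        refine lt_tsub_iff_right.2 (lt_of_le_of_lt ?_ (hρ2 ▸ hρR : (ρ:ENNReal) + ρ < R))
        have h1 : ‖v‖₊ ≤ ρ := hv.le
        have h2 : ‖x - x₀‖₊ ≤ ρ := hy.le
        exact_mod_cast add_le_add h1 h2
      exact hx'.hasSum_iteratedFDeriv hmem

end Nemytskii
end RangeEq

namespace RangeEq

section Abstract

variable {X : Type*} [NormedAddCommGroup X] [NormedSpace ℝ X] [CompleteSpace X]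

theorem fixed_point_family (L : ℝ → X →L[ℝ] X) {C ε₀ ρ δ εb : ℝ} (hρ : 0 < ρ) (hδ : 0 ≤ δ)
    (hCδ : C * δ ≤ 1 / 2)
    (hLb : ∀ ε ∈ Set.Ioo 0 ε₀, ‖L ε‖ ≤ C)
    (hLc : ∀ x, ContinuousOn (fun ε => L ε x) (Set.Ioo 0 ε₀))
    (N : X → X) (F : X)
    (hN : ∀ x ∈ Metric.closedBall (0 : X) ρ, ∀ y ∈ Metric.closedBall (0 : X) ρ,
      ‖N x - N y‖ ≤ δ * ‖x - y‖)
    (hN0 : ∀ ε ∈ Set.Ioo 0 ε₀, L ε (N 0) = 0)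
    (hεb : εb ≤ ε₀)
    (hF : ∀ ε ∈ Set.Ioo 0 εb, ‖L ε F‖ ≤ ρ / 4)
    (hFlim : Tendsto (fun ε => L ε F) (nhdsWithin 0 (Set.Ioi 0)) (nhds 0)) :
    ∃ u : ℝ → X, u 0 = 0 ∧
      (∀ ε ∈ Set.Ioo 0 εb, ‖u ε‖ < ρ ∧ u ε = L ε (F - N (u ε))) ∧
      ContinuousOn u (Set.Ico 0 εb) := by
  have hsub : Set.Ioo 0 εb ⊆ Set.Ioo 0 ε₀ := Set.Ioo_subset_Ioo_right hεb
  have hLN : ∀ ε ∈ Set.Ioo 0 ε₀, ∀ x ∈ Metric.closedBall (0 : X) ρ,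
      ∀ y ∈ Metric.closedBall (0 : X) ρ, ‖L ε (N x - N y)‖ ≤ 1 / 2 * ‖x - y‖ := by
    intro ε hε x hx y hy
    have hC : 0 ≤ C := (norm_nonneg _).trans (hLb ε hε)
    calc ‖L ε (N x - N y)‖ ≤ ‖L ε‖ * ‖N x - N y‖ := (L ε).le_opNorm _
      _ ≤ C * (δ * ‖x - y‖) := by
        gcongr
        · exact hLb ε hε
        · exact hN x hx y hy
      _ = (C * δ) * ‖x - y‖ := by ring
      _ ≤ 1 / 2 * ‖x - y‖ := by gcongr
  have h0mem : (0 : X) ∈ Metric.closedBall (0 : X) ρ := by simp [hρ.le]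
  have hTb : ∀ ε ∈ Set.Ioo 0 ε₀, ∀ x ∈ Metric.closedBall (0 : X) ρ,
      ‖L ε (F - N x)‖ ≤ ‖L ε F‖ + 1 / 2 * ‖x‖ := by
    intro ε hε x hx
    have h1 := hLN ε hε x hx 0 h0mem
    rw [map_sub, hN0 ε hε, sub_zero, sub_zero] at h1
    rw [map_sub]
    exact (norm_sub_le _ _).trans (by gcongr)
  have hex : ∀ ε ∈ Set.Ioo 0 εb, ∃ v : X, v ∈ Metric.closedBall (0 : X) ρ ∧
      L ε (F - N v) = v := by
    intro ε hε
    have hmaps : Set.MapsTo (fun v => L ε (F - N v)) (Metric.closedBall (0 : X) ρ)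
        (Metric.closedBall (0 : X) ρ) := by
      intro v hv
      have h1 := hTb ε (hsub hε) v hv
      have h2 := hF ε hε
      rw [mem_closedBall_zero_iff] at hv ⊢
      linarith
    have hcon : ContractingWith (1 / 2 : NNReal)
        (hmaps.restrict (fun v => L ε (F - N v)) (Metric.closedBall (0 : X) ρ)
          (Metric.closedBall (0 : X) ρ)) := by
      refine ⟨by rw [← NNReal.coe_lt_coe]; norm_num, LipschitzWith.of_dist_le_mul fun x y => ?_⟩
      rw [Subtype.dist_eq, Subtype.dist_eq, dist_eq_norm, dist_eq_norm,
        Set.MapsTo.val_restrict_apply, Set.MapsTo.val_restrict_apply, ← map_sub]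
      have h1 := hLN ε (hsub hε) y y.2 x x.2
      rw [sub_sub_sub_cancel_left]
      rw [norm_sub_rev (x : X)]
      simpa using h1
    obtain ⟨v, hv, hfix, -⟩ := hcon.exists_fixedPoint' (Metric.isClosed_closedBall.isComplete)
      hmaps h0mem (edist_ne_top _ _)
    exact ⟨v, hv, hfix⟩
  choose! u₀ hu₀ hfix using hex
  set u : ℝ → X := fun ε => if ε ∈ Set.Ioo 0 εb then u₀ ε else 0 with hu
  have huε : ∀ ε ∈ Set.Ioo 0 εb, u ε = u₀ ε := fun ε hε => by rw [hu]; simp only; rw [if_pos hε]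
  have hu0 : u 0 = 0 := by simp [hu]
  have hub : ∀ ε ∈ Set.Ioo 0 εb, ‖u ε‖ ≤ 2 * ‖L ε F‖ := by
    intro ε hε
    have h1 := hTb ε (hsub hε) _ (hu₀ ε hε)
    rw [hfix ε hε] at h1
    rw [huε ε hε]
    linarith
  refine ⟨u, hu0, fun ε hε => ⟨?_, ?_⟩, ?_⟩
  · have := hub ε hε
    have h2 := hF ε hε
    linarith
  · rw [huε ε hε]; exact (hfix ε hε).symm
  · intro ε₁ hε₁
    rcases eq_or_lt_of_le hε₁.1 with h0 | hpos
    · subst h0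
      rw [ContinuousWithinAt, hu0]
      have hz : Tendsto u (nhdsWithin 0 (Set.Ioo 0 εb)) (nhds 0) := by
        have h2 : Tendsto (fun ε => 2 * ‖L ε F‖) (nhdsWithin 0 (Set.Ioo 0 εb)) (nhds 0) := by
          have := (hFlim.norm.const_mul 2).mono_left
            (nhdsWithin_mono (0:ℝ) (fun x (hx : x ∈ Set.Ioo 0 εb) => hx.1))
          simpa using this
        refine squeeze_zero_norm' ?_ h2
        filter_upwards [self_mem_nhdsWithin] with ε hε using hub ε hε
      have hins : Set.Ico 0 εb = insert 0 (Set.Ioo 0 εb) := by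
        rw [Set.Ioo_insert_left hε₁.2]
      rw [hins, nhdsWithin_insert]
      refine Tendsto.sup ?_ hz
      rw [tendsto_pure_left]
      intro s hs
      rw [hu0]
      exact mem_of_mem_nhds hs
    · have hmem : ε₁ ∈ Set.Ioo 0 εb := ⟨hpos, hε₁.2⟩
      refine ContinuousAt.continuousWithinAt ?_
      have hnhds : Set.Ioo 0 εb ∈ nhds ε₁ := Ioo_mem_nhds hpos hε₁.2
      have hc := ((hLc (F - N (u ε₁))).mono hsub).continuousAt hnhds
      have hc2 : Tendsto (fun ε => 2 * ‖L ε (F - N (u ε₁)) - L ε₁ (F - N (u ε₁))‖) (nhds ε₁)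
          (nhds 0) := by
        have := ((hc.tendsto.sub_const (L ε₁ (F - N (u ε₁)))).norm).const_mul 2
        simpa using this
      rw [ContinuousAt, tendsto_iff_norm_sub_tendsto_zero]
      refine squeeze_zero' (Eventually.of_forall fun _ => norm_nonneg _) ?_ hc2
      filter_upwards [hnhds] with ε hε
      have e1 : u ε - u ε₁ = L ε (N (u ε₁) - N (u ε))
          + (L ε (F - N (u ε₁)) - L ε₁ (F - N (u ε₁))) := by
        have a1 := hfix ε hε
        have a2 := hfix ε₁ hmem
        rw [← huε ε hε] at a1
        rw [← huε ε₁ hmem] at a2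
        rw [a2]
        conv_lhs => rw [← a1]
        simp only [map_sub]
        abel
      have e2 := hLN ε (hsub hε) (u ε₁) (by rw [huε ε₁ hmem]; exact hu₀ ε₁ hmem) (u ε)
        (by rw [huε ε hε]; exact hu₀ ε hε)
      have e3 := norm_add_le (L ε (N (u ε₁) - N (u ε)))
        (L ε (F - N (u ε₁)) - L ε₁ (F - N (u ε₁)))
      rw [← e1] at e3
      rw [norm_sub_rev (u ε₁)] at e2
      linarith

theorem analytic_of_implicit {P : Type*} [NormedAddCommGroup P] [NormedSpace ℝ P]
    (L : X →L[ℝ] X) {C δ ρ : ℝ} (hδ : 0 ≤ δ) (hL : ‖L‖ ≤ C) (hCδ : C * δ ≤ 1 / 2)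
    (N : X → X)
    (hN : ∀ x ∈ Metric.closedBall (0 : X) ρ, ∀ y ∈ Metric.closedBall (0 : X) ρ,
      ‖N x - N y‖ ≤ δ * ‖x - y‖) {u₀ : X} (hu₀ : ‖u₀‖ < ρ) (hNa : AnalyticAt ℝ N u₀)
    (w k : P → X) (p₀ : P) (hw0 : w p₀ = u₀) (hw : ContinuousAt w p₀) (hk : AnalyticAt ℝ k p₀)
    (hwk : ∀ p, w p + L (N (w p)) = k p) : AnalyticAt ℝ w p₀ := by
  set Ψ : X → X := fun v => v + L (N v) with hΨ
  have hΨa : AnalyticAt ℝ Ψ u₀ := analyticAt_id.add ((L.analyticAt _).comp hNa)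
  have hd : HasStrictFDerivAt (fun v => L (N v)) (L.comp (fderiv ℝ N u₀)) u₀ :=
    L.hasStrictFDerivAt.comp u₀ hNa.hasStrictFDerivAt
  have hCδ0 : 0 ≤ C * δ := mul_nonneg ((norm_nonneg _).trans hL) hδ
  have hle : ‖L.comp (fderiv ℝ N u₀)‖ ≤ 1 / 2 := by
    refine le_trans (HasFDerivAt.le_of_lip' hd.hasFDerivAt hCδ0 ?_) hCδ
    have hball : Metric.closedBall (0 : X) ρ ∈ nhds u₀ :=
      mem_of_superset (Metric.isOpen_ball.mem_nhds (mem_ball_zero_iff.2 hu₀))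
        Metric.ball_subset_closedBall
    filter_upwards [hball] with x hx
    rw [← map_sub]
    calc ‖L (N x - N u₀)‖ ≤ ‖L‖ * ‖N x - N u₀‖ := L.le_opNorm _
      _ ≤ C * (δ * ‖x - u₀‖) := by
        gcongr
        · exact (norm_nonneg _).trans hL
        · exact hN x hx u₀ (mem_of_mem_nhds hball)
      _ = (C * δ) * ‖x - u₀‖ := by ring
  have hlt : ‖-(L.comp (fderiv ℝ N u₀))‖ < 1 := by rw [norm_neg]; linarith
  let i : X ≃L[ℝ] X := ContinuousLinearEquiv.ofUnit (Units.oneSub _ hlt)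
  have hi : (i : X →L[ℝ] X) = ContinuousLinearMap.id ℝ X + L.comp (fderiv ℝ N u₀) := by
    ext v
    change ((Units.oneSub _ hlt : (X →L[ℝ] X)ˣ) : X →L[ℝ] X) v = _
    rw [Units.val_oneSub, sub_neg_eq_add]
    rfl
  have hst : HasStrictFDerivAt Ψ (i : X →L[ℝ] X) u₀ := by
    rw [hi]
    exact (hasStrictFDerivAt_id u₀).add hd
  let R := hst.toOpenPartialHomeomorph Ψ
  have hmem : u₀ ∈ R.source := hst.mem_toOpenPartialHomeomorph_source
  have hsymm : AnalyticAt ℝ R.symm (R u₀) :=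
    R.analyticAt_symm' hmem hΨa hst.hasFDerivAt.fderiv
  have hk0 : k p₀ = R u₀ := by rw [← hwk p₀, hw0]; rfl
  have hcomp : AnalyticAt ℝ (fun p => R.symm (k p)) p₀ := by
    rw [← hk0] at hsymm
    exact AnalyticAt.comp hsymm hk
  refine hcomp.congr ?_
  have hev : ∀ᶠ p in nhds p₀, w p ∈ R.source := hw.eventually (by
    rw [hw0]; exact R.open_source.mem_nhds hmem)
  filter_upwards [hev] with p hp
  rw [← hwk p]
  exact R.left_inv hp

end Abstract
end RangeEq

namespace RangeEq

section Torus

variable {d : ℕ}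

/-- projection of `ℝ^d` onto the torus. -/
def tproj (ψ : Fin d → ℝ) : UnitAddTorus (Fin d) := fun j => ((ψ j / (2 * π) : ℝ) : UnitAddCircle)

lemma tproj_add (ψ φ : Fin d → ℝ) : tproj (ψ + φ) = tproj ψ + tproj φ := by
  funext j
  simp [tproj, add_div]

lemma tproj_zero : tproj (0 : Fin d → ℝ) = 0 := by
  funext j
  simp [tproj]

lemma tproj_quot : IsOpenQuotientMap (tproj (d := d)) := by
  have h : IsOpenQuotientMap (Pi.map fun (_ : Fin d) (x : ℝ) => ((x / (2 * π) : ℝ) : UnitAddCircle)) := by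
    refine IsOpenQuotientMap.piMap fun _ => ?_
    have h1 : IsOpenQuotientMap (fun x : ℝ => (x : UnitAddCircle)) :=
      QuotientAddGroup.isOpenQuotientMap_mk
    have h2 : IsOpenQuotientMap (fun x : ℝ => x / (2 * π)) := by
      have := (Homeomorph.mulRight₀ ((2 * π)⁻¹ : ℝ) (by positivity)).isOpenQuotientMap
      convert this using 1
      funext x
      simp [div_eq_mul_inv]
    exact h1.comp h2
  exact h

lemma tproj_cont : Continuous (tproj (d := d)) := tproj_quot.continuous

lemma tproj_periodic (ψ : Fin d → ℝ) (k : Fin d → ℤ) :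
    tproj (fun j => ψ j + 2 * π * k j) = tproj ψ := by
  funext j
  have : (ψ j + 2 * π * k j) / (2 * π) = ψ j / (2 * π) + k j := by
    field_simp
  simp only [tproj, this]
  rw [AddCircle.coe_add]
  have h2 : (((k j : ℤ) : ℝ) : UnitAddCircle) = 0 := by
    rw [AddCircle.coe_eq_zero_iff]
    exact ⟨k j, by simp⟩
  rw [h2, add_zero]

lemma tproj_eq {ψ φ : Fin d → ℝ} (h : tproj ψ = tproj φ) :
    ∃ k : Fin d → ℤ, ψ = fun j => φ j + 2 * π * k j := by
  have : ∀ j, ∃ k : ℤ, ψ j = φ j + 2 * π * k := by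
    intro j
    have h1 := congrFun h j
    simp only [tproj] at h1
    rw [← sub_eq_zero, ← AddCircle.coe_sub, AddCircle.coe_eq_zero_iff] at h1
    obtain ⟨n, hn⟩ := h1
    refine ⟨n, ?_⟩
    rw [zsmul_eq_mul, mul_one] at hn
    rw [hn]
    field_simp
    ring
  choose k hk using this
  exact ⟨k, funext hk⟩

lemma exists_descend {Z : Type*} [TopologicalSpace Z] (F : (Fin d → ℝ) → Z) (hF : Continuous F)
    (hp : ∀ (ψ : Fin d → ℝ) (k : Fin d → ℤ), F (fun j => ψ j + 2 * π * k j) = F ψ) :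
    ∃ G : C(UnitAddTorus (Fin d), Z), ∀ ψ, G (tproj ψ) = F ψ := by
  have hq : Topology.IsQuotientMap (⟨tproj, tproj_cont⟩ : C(Fin d → ℝ, UnitAddTorus (Fin d))) :=
    tproj_quot.isQuotientMap
  have hfac : Function.FactorsThrough (⟨F, hF⟩ : C(Fin d → ℝ, Z))
      (⟨tproj, tproj_cont⟩ : C(Fin d → ℝ, UnitAddTorus (Fin d))) := by
    intro a b hab
    obtain ⟨k, hk⟩ := tproj_eq (d := d) (ψ := a) (φ := b) hab
    change F a = F b
    rw [hk, hp]
  refine ⟨hq.lift ⟨F, hF⟩ hfac, fun ψ => ?_⟩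
  have := hq.lift_comp ⟨F, hF⟩ hfac
  exact congrArg (fun G : C(Fin d → ℝ, Z) => G ψ) this

variable {E : Type*} [NormedAddCommGroup E] [NormedSpace ℝ E]

/-- translation operators. -/
def shift (θ : UnitAddTorus (Fin d)) :
    C(UnitAddTorus (Fin d), E) →L[ℝ] C(UnitAddTorus (Fin d), E) :=
  LinearMap.mkContinuous
    { toFun := fun u => ⟨fun x => u (x + θ), by fun_prop⟩
      map_add' := fun _ _ => rfl
      map_smul' := fun _ _ => rfl } 1 (fun u => by
        rw [one_mul, ContinuousMap.norm_le _ (norm_nonneg _)]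
        intro x
        exact u.norm_coe_le_norm (x + θ))

@[simp] lemma shift_apply (θ : UnitAddTorus (Fin d)) (u : C(UnitAddTorus (Fin d), E))
    (x : UnitAddTorus (Fin d)) : shift θ u x = u (x + θ) := rfl

lemma shift_norm (θ : UnitAddTorus (Fin d)) (u : C(UnitAddTorus (Fin d), E)) :
    ‖shift θ u‖ ≤ ‖u‖ := by
  rw [ContinuousMap.norm_le _ (norm_nonneg _)]
  intro x
  exact u.norm_coe_le_norm (x + θ)

lemma shift_cont (u : C(UnitAddTorus (Fin d), E)) : Continuous fun θ => shift θ u := by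
  refine ContinuousMap.continuous_of_continuous_uncurry _ ?_
  change Continuous fun p : UnitAddTorus (Fin d) × UnitAddTorus (Fin d) => u (p.2 + p.1)
  fun_prop

lemma shift_flow (ω : Fin d → ℝ) :
    IsFlow (fun t : ℝ => (shift (tproj (t • ω)) :
      C(UnitAddTorus (Fin d), E) →L[ℝ] C(UnitAddTorus (Fin d), E))) where
  zero := by
    ext u x
    simp [tproj_zero]
  add := by
    intro s t
    ext u x
    change u (x + tproj ((s + t) • ω)) = u (x + tproj (s • ω) + tproj (t • ω))
    rw [add_smul, tproj_add, add_assoc]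
  norm_le := fun t u => shift_norm _ u
  cont := fun u => (shift_cont u).comp (tproj_cont.comp (by fun_prop))

lemma shift_post (θ : UnitAddTorus (Fin d)) (A : E →L[ℝ] E) :
    Commute (post (UnitAddTorus (Fin d)) A) (shift θ) := by
  ext u x
  rfl

lemma shift_shift (θ η : UnitAddTorus (Fin d)) :
    Commute (shift θ : C(UnitAddTorus (Fin d), E) →L[ℝ] C(UnitAddTorus (Fin d), E)) (shift η) := by
  ext u x
  change u (x + θ + η) = u (x + η + θ)
  rw [add_right_comm]

variable [CompleteSpace E]

/-- normalized Haar measure on the torus -/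
abbrev haarT (d : ℕ) : MeasureTheory.Measure (UnitAddTorus (Fin d)) :=
  MeasureTheory.Measure.pi fun _ => AddCircle.haarAddCircle

lemma integrable_torus (u : C(UnitAddTorus (Fin d), E)) :
    MeasureTheory.Integrable (fun x => u x) (haarT d) := by
  exact u.continuous.integrable_of_hasCompactSupport (HasCompactSupport.of_compactSpace _)

/-- the mean, as an operator to constant functions. -/
def meanOp (d : ℕ) (E : Type*) [NormedAddCommGroup E] [NormedSpace ℝ E] [CompleteSpace E] :
    C(UnitAddTorus (Fin d), E) →L[ℝ] C(UnitAddTorus (Fin d), E) :=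
  LinearMap.mkContinuous
    { toFun := fun u => ContinuousMap.const _ (∫ x, u x ∂(haarT d))
      map_add' := fun u v => by
        ext1 x
        exact MeasureTheory.integral_add (integrable_torus u) (integrable_torus v)
      map_smul' := fun a u => by
        ext1 x
        exact MeasureTheory.integral_smul a _ } 1 (fun u => by
        rw [one_mul, ContinuousMap.norm_le _ (norm_nonneg _)]
        intro x
        refine (MeasureTheory.norm_integral_le_of_norm_le_const (C := ‖u‖)
          (Eventually.of_forall fun x => u.norm_coe_le_norm x)).trans ?_
        simp)

@[simp] lemma meanOp_apply (u : C(UnitAddTorus (Fin d), E)) (x : UnitAddTorus (Fin d)) :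
    meanOp d E u x = ∫ y, u y ∂(haarT d) := rfl

lemma meanOp_shift (θ : UnitAddTorus (Fin d)) : Commute (meanOp d E) (shift θ) := by
  ext u x
  change ∫ y, u (y + θ) ∂(haarT d) = ∫ y, u y ∂(haarT d)
  exact MeasureTheory.integral_add_right_eq_self (fun y => u y) θ

lemma meanOp_post (A : E →L[ℝ] E) : Commute (meanOp d E) (post (UnitAddTorus (Fin d)) A) := by
  ext u x
  change ∫ y, A (u y) ∂(haarT d) = A (∫ y, u y ∂(haarT d))
  exact A.integral_comp_comm (integrable_torus u)

lemma meanOp_const (e : E) : meanOp d E (ContinuousMap.const _ e) = ContinuousMap.const _ e := by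
  ext1 x
  simp

lemma meanOp_idem (u : C(UnitAddTorus (Fin d), E)) : meanOp d E (meanOp d E u) = meanOp d E u :=
  meanOp_const _

open scoped Pointwise in
lemma boxMean_tproj {m : ℕ} (U : C(UnitAddTorus (Fin d), Fin m → ℝ)) :
    boxMean d m (fun ψ => U (tproj ψ)) = ∫ x, U x ∂(haarT d) := by
  have hpi : (0:ℝ) < (2 * π)⁻¹ := by positivity
  have h0 : ∫ x, U x ∂(haarT d) = ∫ (x : Fin d → ℝ) in
      {x : Fin d → ℝ | ∀ i, x i ∈ Set.Ioc ((0 : Fin d → ℝ) i) ((0 : Fin d → ℝ) i + 1)},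
        U (fun i => x i) := UnitAddTorus.integral_preimage (fun x => U x) 0
  rw [h0]
  have hset : {x : Fin d → ℝ | ∀ i, x i ∈ Set.Ioc ((0 : Fin d → ℝ) i) ((0 : Fin d → ℝ) i + 1)}
      =ᵐ[MeasureTheory.volume] (Set.univ.pi fun _ : Fin d => Set.Icc (0:ℝ) 1) := by
    have := MeasureTheory.Measure.pi_Ioc_ae_eq_pi_Icc (μ := fun _ : Fin d => (MeasureTheory.volume : MeasureTheory.Measure ℝ))
      (s := Set.univ) (f := fun _ => 0) (g := fun _ => 1)
    rw [← MeasureTheory.volume_pi] at this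
    have heq : {x : Fin d → ℝ | ∀ i, x i ∈ Set.Ioc ((0 : Fin d → ℝ) i) ((0 : Fin d → ℝ) i + 1)}
        = Set.univ.pi fun _ => Set.Ioc (0:ℝ) 1 := by
      ext x
      simp [Set.mem_pi]
    rw [heq]
    exact this
  rw [MeasureTheory.setIntegral_congr_set hset]
  have h1 := MeasureTheory.Measure.setIntegral_comp_smul_of_pos (MeasureTheory.volume : MeasureTheory.Measure (Fin d → ℝ))
    (fun x : Fin d → ℝ => U (fun i => ((x i : ℝ) : UnitAddCircle)))
    (Set.univ.pi fun _ : Fin d => Set.Icc (0 : ℝ) (2 * π)) hpi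
  have hsm : (2 * π)⁻¹ • (Set.univ.pi fun _ : Fin d => Set.Icc (0 : ℝ) (2 * π))
      = (Set.univ.pi fun _ : Fin d => Set.Icc (0:ℝ) 1) := by
    rw [smul_univ_pi]
    congr 1
    funext i
    simp only [Pi.smul_apply]
    rw [LinearOrderedField.smul_Icc hpi, mul_zero,
      inv_mul_cancel₀ (by positivity)]
  rw [hsm] at h1
  rw [boxMean]
  have h2 : ∀ ψ : Fin d → ℝ, U (tproj ψ)
      = U (fun i => ((((2 * π)⁻¹ • ψ) i : ℝ) : UnitAddCircle)) := by
    intro ψ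
    congr 1
    funext i
    simp only [tproj, Pi.smul_apply, smul_eq_mul]
    rw [div_eq_inv_mul]
  simp_rw [h2]
  rw [h1, smul_smul]
  rw [Module.finrank_fin_fun, mul_inv_cancel₀ (by positivity), one_smul]

end Torus
end RangeEq

namespace RangeEq

section Torus2

variable {d : ℕ}

lemma tproj_surj_box (θ : UnitAddTorus (Fin d)) :
    ∃ ψ ∈ (Set.Icc 0 (fun _ => 2 * π) : Set (Fin d → ℝ)), tproj ψ = θ := by
  obtain ⟨ψ, rfl⟩ := tproj_quot.surjective θ
  have hpi : (0:ℝ) < 2 * π := by positivity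
  refine ⟨fun j => ψ j + 2 * π * ((-⌊ψ j / (2 * π)⌋ : ℤ) : ℝ), ⟨fun j => ?_, fun j => ?_⟩,
    tproj_periodic ψ fun j => -⌊ψ j / (2 * π)⌋⟩
  · have h := Int.floor_le (ψ j / (2 * π))
    rw [le_div_iff₀ hpi] at h
    simp only [Pi.zero_apply]
    push_cast
    linarith
  · have h := Int.lt_floor_add_one (ψ j / (2 * π))
    rw [div_lt_iff₀ hpi] at h
    push_cast
    linarith

variable {E : Type*} [NormedAddCommGroup E] [NormedSpace ℝ E] [CompleteSpace E]

theorem shift_analytic (f : (Fin d → ℝ) → E) (hf : AnalyticOnNhd ℝ f Set.univ)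
    (hp : ∀ (ψ : Fin d → ℝ) (k : Fin d → ℤ), f (fun j => ψ j + 2 * π * k j) = f ψ)
    (F : C(UnitAddTorus (Fin d), E)) (hF : ∀ ψ, F (tproj ψ) = f ψ) :
    AnalyticAt ℝ (fun φ : Fin d → ℝ => shift (tproj φ) F) 0 := by
  obtain ⟨C, a, r, hC, ha, hr, hT⟩ := uniform_taylor hf
    (isCompact_Icc : IsCompact (Set.Icc 0 (fun _ => 2 * π) : Set (Fin d → ℝ)))
  have hcd : ContDiff ℝ ⊤ f := hf.contDiff
  have hex : ∀ n : ℕ, ∃ G : C(UnitAddTorus (Fin d), (Fin d → ℝ) [×n]→L[ℝ] E),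
      ∀ ψ, G (tproj ψ) = (n.factorial : ℝ)⁻¹ • iteratedFDeriv ℝ n f ψ := by
    intro n
    refine exists_descend (fun ψ => (n.factorial : ℝ)⁻¹ • iteratedFDeriv ℝ n f ψ)
      (by have := hcd.continuous_iteratedFDeriv (m := n) (by exact le_top); fun_prop) fun ψ k => ?_
    have h1 := iteratedFDeriv_comp_add_right (𝕜 := ℝ) (f := f) n (fun j => 2 * π * k j) ψ
    have h2 : (fun z => f (z + fun j => 2 * π * (k j : ℝ))) = f := funext fun z => hp z k
    rw [h2] at h1
    rw [h1]
    rfl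
  choose G hG using hex
  have hps := hasFPowerSeries_lift G (C := C) (a := a) (r := min r a⁻¹) ha (fun n => by
      rw [ContinuousMap.norm_le _ (by positivity)]
      intro θ
      obtain ⟨ψ, hψ, rfl⟩ := tproj_surj_box θ
      rw [hG]
      exact (hT ψ hψ).1 n) (lt_min hr (by positivity))
    (by
      calc min r a⁻¹ * a ≤ a⁻¹ * a := by gcongr; exact min_le_right _ _
        _ = 1 := inv_mul_cancel₀ ha.ne')
    (fun v : C(UnitAddTorus (Fin d), Fin d → ℝ) =>
      (⟨fun θ => F (θ + tproj (v θ)), by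
        have := tproj_cont (d := d)
        fun_prop⟩ : C(UnitAddTorus (Fin d), E)))
    (fun v hv θ => by
      obtain ⟨ψ, hψ, rfl⟩ := tproj_surj_box θ
      have h1 := (hT ψ hψ).2 (v (tproj ψ))
        (lt_of_le_of_lt (v.norm_coe_le_norm _) (hv.trans_le (min_le_left _ _)))
      rw [← hF, tproj_add] at h1
      simp_rw [← hG] at h1
      exact h1)
  let J : (Fin d → ℝ) →L[ℝ] C(UnitAddTorus (Fin d), Fin d → ℝ) :=
    LinearMap.mkContinuous
      { toFun := fun e => ContinuousMap.const _ e
        map_add' := fun _ _ => rfl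
        map_smul' := fun _ _ => rfl } 1 (fun e => by
          rw [one_mul, ContinuousMap.norm_le _ (norm_nonneg _)]
          intro x
          exact le_rfl)
  have h2 := hps.analyticAt
  have hJ0 : J 0 = 0 := map_zero J
  rw [← hJ0] at h2
  exact h2.comp (J.analyticAt 0)

lemma mFourier_tproj (ν : Fin d → ℤ) (ψ : Fin d → ℝ) :
    UnitAddTorus.mFourier ν (tproj ψ) = Complex.exp (((∑ j, ψ j * ν j : ℝ) : ℂ) * Complex.I) := by
  have hpi : (π : ℂ) ≠ 0 := by exact_mod_cast Real.pi_ne_zero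
  simp only [UnitAddTorus.mFourier, ContinuousMap.coe_mk, tproj]
  rw [Complex.ofReal_sum, Finset.sum_mul, Complex.exp_sum]
  refine Finset.prod_congr rfl fun j _ => ?_
  rw [fourier_coe_apply]
  congr 1
  push_cast
  field_simp

lemma mFourier_shift (ν : Fin d → ℤ) (ω : Fin d → ℝ) (hω : (∑ j, ω j * ν j) ≠ 0)
    (θ : UnitAddTorus (Fin d)) :
    UnitAddTorus.mFourier ν (θ + tproj ((π / ∑ j, ω j * ν j) • ω)) = -UnitAddTorus.mFourier ν θ := by
  obtain ⟨ψ, rfl⟩ := tproj_quot.surjective θ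
  rw [← tproj_add, mFourier_tproj, mFourier_tproj]
  have : (∑ j, (ψ + (π / ∑ j, ω j * ν j) • ω) j * ν j : ℝ) = (∑ j, ψ j * ν j) + π := by
    simp only [Pi.add_apply, Pi.smul_apply, smul_eq_mul, add_mul, Finset.sum_add_distrib]
    simp_rw [mul_assoc]
    rw [← Finset.mul_sum, div_mul_cancel₀ _ hω]
  rw [this, Complex.ofReal_add, add_mul, Complex.exp_add, Complex.exp_pi_mul_I, mul_neg_one]

/-- the complement of the mean projection. -/
def proj0 (d : ℕ) (E : Type*) [NormedAddCommGroup E] [NormedSpace ℝ E] [CompleteSpace E] :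
    C(UnitAddTorus (Fin d), E) →L[ℝ] C(UnitAddTorus (Fin d), E) :=
  ContinuousLinearMap.id ℝ _ - meanOp d E

lemma proj0_apply (u : C(UnitAddTorus (Fin d), E)) : proj0 d E u = u - meanOp d E u := rfl

/-- The space of data for which the averaged solution tends to zero is everything. -/
theorem dense_modes {m : ℕ} (S : Submodule ℝ C(UnitAddTorus (Fin d), Fin m → ℝ))
    (hS : IsClosed (S : Set C(UnitAddTorus (Fin d), Fin m → ℝ)))
    (hmode : ∀ (ν : Fin d → ℤ) (a : ℂ) (v : Fin m → ℝ) (h : C(UnitAddTorus (Fin d), Fin m → ℝ)),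
      (∀ θ, h θ = (a * UnitAddTorus.mFourier ν θ).re • v) → h ∈ S) :
    ∀ h, h ∈ S := by
  let J : (Fin m → ℝ) → C(UnitAddTorus (Fin d), ℂ) →L[ℝ] C(UnitAddTorus (Fin d), Fin m → ℝ) :=
    fun v => (Complex.reCLM.smulRight v : ℂ →L[ℝ] (Fin m → ℝ)).compLeftContinuous ℝ _
  have hJ : ∀ v p θ, J v p θ = (p θ).re • v := fun _ _ _ => rfl
  let S' : Submodule ℂ C(UnitAddTorus (Fin d), ℂ) :=
    { carrier := {p | ∀ (a : ℂ) v, J v (a • p) ∈ S}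
      add_mem' := fun {p q} hp hq a v => by
        have e : a • (p + q) = a • p + a • q := by
          ext θ
          exact mul_add _ _ _
        rw [e, map_add]; exact S.add_mem (hp a v) (hq a v)
      zero_mem' := fun a v => by
        rw [smul_zero, map_zero]; exact S.zero_mem
      smul_mem' := fun b p hp a v => by
        rw [smul_smul]; exact hp (a * b) v }
  have hcl : IsClosed (S' : Set C(UnitAddTorus (Fin d), ℂ)) := by
    have : (S' : Set C(UnitAddTorus (Fin d), ℂ)) = ⋂ (a : ℂ), ⋂ v, (fun p => J v (a • p)) ⁻¹' S := by
      ext p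
      simp only [Set.mem_iInter, Set.mem_preimage]
      rfl
    rw [this]
    refine isClosed_iInter fun a => isClosed_iInter fun v => hS.preimage ?_
    exact (J v).continuous.comp (continuous_const_smul a)
  have htop : S' = ⊤ := by
    rw [eq_top_iff, ← UnitAddTorus.span_mFourier_closure_eq_top]
    refine Submodule.topologicalClosure_minimal _ ?_ hcl
    rw [Submodule.span_le]
    rintro _ ⟨ν, rfl⟩ a v
    exact hmode ν a v _ fun θ => rfl
  intro h
  have hh : h = ∑ i, J (Pi.single i 1)
      (⟨fun θ => ((h θ i : ℝ) : ℂ), by fun_prop⟩ : C(UnitAddTorus (Fin d), ℂ)) := by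
    ext θ i
    simp [hJ, Finset.sum_apply, Pi.single_apply]
  rw [hh]
  refine S.sum_mem fun i _ => ?_
  have : (⟨fun θ => ((h θ i : ℝ) : ℂ), by fun_prop⟩ : C(UnitAddTorus (Fin d), ℂ)) ∈ S' := by
    rw [htop]; trivial
  have h2 := this 1 (Pi.single i 1)
  rwa [one_smul] at h2

theorem averaged_tendsto {m : ℕ} (ω : Fin d → ℝ)
    (hω : ∀ ν : Fin d → ℤ, ν ≠ 0 → (∑ j, ω j * ν j) ≠ 0)
    {ε₀ C : ℝ} (hε₀ : 0 < ε₀)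
    (K : ℝ → C(UnitAddTorus (Fin d), Fin m → ℝ) →L[ℝ] C(UnitAddTorus (Fin d), Fin m → ℝ))
    (S : C(UnitAddTorus (Fin d), Fin m → ℝ) →L[ℝ] C(UnitAddTorus (Fin d), Fin m → ℝ))
    (hK : ∀ ε ∈ Set.Ioo 0 ε₀, ‖K ε‖ ≤ C)
    (hKs : ∀ ε ∈ Set.Ioo 0 ε₀, ∀ θ, Commute (shift θ) (K ε))
    (hKd : ∀ ε ∈ Set.Ioo 0 ε₀, ∀ x, ∃ q, ‖q‖ ≤ C * ‖x‖ ∧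
      HasDerivAt (fun t : ℝ => shift (tproj (t • ω)) (K ε x)) (ε • (q - S (K ε x))) 0)
    (h : C(UnitAddTorus (Fin d), Fin m → ℝ)) :
    Tendsto (fun ε => K ε (proj0 d (Fin m → ℝ) h)) (nhdsWithin 0 (Set.Ioi 0)) (nhds 0) := by
  have hC : 0 ≤ C := (norm_nonneg (K (ε₀ / 2))).trans (hK (ε₀ / 2) ⟨by linarith, by linarith⟩)
  have hev : ∀ᶠ ε in nhdsWithin (0:ℝ) (Set.Ioi 0), ε ∈ Set.Ioo 0 ε₀ := Ioo_mem_nhdsGT hε₀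
  let W : Submodule ℝ C(UnitAddTorus (Fin d), Fin m → ℝ) :=
    { carrier := {h | Tendsto (fun ε => K ε (proj0 d (Fin m → ℝ) h))
        (nhdsWithin 0 (Set.Ioi 0)) (nhds 0)}
      add_mem' := fun {p q} hp hq => by
        have := Tendsto.add hp hq
        simpa only [Set.mem_ofPred_eq, map_add, add_zero] using this
      zero_mem' := by simp
      smul_mem' := fun b p hp => by
        have := Tendsto.const_smul hp b
        simpa only [Set.mem_ofPred_eq, map_smul, smul_zero] using this }
  refine dense_modes W ?_ ?_ h
  · rw [← isSeqClosed_iff_isClosed]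
    intro x p hx hxp
    change Tendsto (fun ε => K ε (proj0 d (Fin m → ℝ) p)) (nhdsWithin 0 (Set.Ioi 0)) (nhds 0)
    have hB : Tendsto (fun n => C * ‖proj0 d (Fin m → ℝ) (p - x n)‖) atTop (nhds 0) := by
      have h1 : Tendsto (fun n => p - x n) atTop (nhds 0) := by
        simpa using (tendsto_const_nhds (x := p)).sub hxp
      have h2 := (((proj0 d (Fin m → ℝ)).continuous.tendsto 0).comp h1).norm.const_mul C
      simpa using h2
    rw [Metric.tendsto_nhds]
    intro η hη
    obtain ⟨n, hn⟩ := ((tendsto_order.1 hB).2 (η / 2) (by linarith)).exists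
    have h3 := Metric.tendsto_nhds.1 (hx n : Tendsto _ _ _) (η / 2) (by linarith)
    filter_upwards [h3, hev] with ε h4 hε
    rw [dist_zero_right] at h4 ⊢
    have h5 : K ε (proj0 d (Fin m → ℝ) p) = K ε (proj0 d (Fin m → ℝ) (p - x n))
        + K ε (proj0 d (Fin m → ℝ) (x n)) := by
      rw [← map_add, ← map_add, sub_add_cancel]
    rw [h5]
    refine (norm_add_le _ _).trans_lt ?_
    have h6 := (K ε).le_of_opNorm_le (hK ε hε) (proj0 d (Fin m → ℝ) (p - x n))
    linarith
  · intro ν a v h hh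
    change Tendsto (fun ε => K ε (proj0 d (Fin m → ℝ) h)) (nhdsWithin 0 (Set.Ioi 0)) (nhds 0)
    by_cases hν : ν = 0
    · have : proj0 d (Fin m → ℝ) h = 0 := by
        have hc : h = ContinuousMap.const _ (a.re • v) := by
          ext1 θ
          rw [hh, hν, UnitAddTorus.mFourier_zero]
          simp
        rw [hc, proj0_apply, meanOp_const, sub_self]
      simp [this]
    · have hx := hω ν hν
      set T : ℝ := π / ∑ j, ω j * ν j with hT
      have hs : shift (tproj (T • ω)) h = -h := by
        ext1 θ
        rw [shift_apply, hh, mFourier_shift ν ω hx, ContinuousMap.neg_apply, hh, mul_neg,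
          Complex.neg_re, neg_smul]
      have hm : meanOp d (Fin m → ℝ) h = 0 := by
        have h1 := congrArg (fun A => A h) (meanOp_shift (E := Fin m → ℝ) (tproj (T • ω))).eq
        have h1 : meanOp d (Fin m → ℝ) (shift (tproj (T • ω)) h)
          = shift (tproj (T • ω)) (meanOp d (Fin m → ℝ) h) := h1
        rw [hs, map_neg] at h1
        have h2 : shift (tproj (T • ω)) (meanOp d (Fin m → ℝ) h) = meanOp d (Fin m → ℝ) h := rfl
        rw [h2] at h1
        have h3 : (2:ℝ) • meanOp d (Fin m → ℝ) h = 0 := by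
          rw [two_smul]
          nth_rewrite 1 [← h1]
          exact neg_add_cancel _
        exact (smul_eq_zero.1 h3).resolve_left two_ne_zero
      rw [proj0_apply, hm, sub_zero]
      have hlim : Tendsto (fun ε : ℝ => ε * ((C * ‖h‖ + ‖S‖ * (C * ‖h‖)) * |T|))
          (nhdsWithin 0 (Set.Ioi 0)) (nhds 0) := by
        have : Tendsto (fun ε : ℝ => ε * ((C * ‖h‖ + ‖S‖ * (C * ‖h‖)) * |T|)) (nhds 0)
          (nhds (0 * ((C * ‖h‖ + ‖S‖ * (C * ‖h‖)) * |T|))) := by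
          exact tendsto_id.mul_const _
        rw [zero_mul] at this
        exact this.mono_left nhdsWithin_le_nhds
      refine squeeze_zero_norm' ?_ hlim
      filter_upwards [hev] with ε hε
      obtain ⟨q, hq, hd⟩ := hKd ε hε h
      have hKT : shift (tproj (T • ω)) (K ε h) = -K ε h := by
        have h1 := congrArg (fun A => A h) (hKs ε hε (tproj (T • ω))).eq
        have h1 : shift (tproj (T • ω)) (K ε h) = K ε (shift (tproj (T • ω)) h) := h1
        rw [h1, hs, map_neg]
      have h2 := flow_reversed_small (shift_flow (E := Fin m → ℝ) ω) hd (T := T) hKT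
      have h3 : ‖K ε h‖ ≤ C * ‖h‖ := (K ε).le_of_opNorm_le (hK ε hε) h
      have h4 : ‖ε • (q - S (K ε h))‖ ≤ ε * (C * ‖h‖ + ‖S‖ * (C * ‖h‖)) := by
        rw [norm_smul, Real.norm_of_nonneg hε.1.le]
        refine mul_le_mul_of_nonneg_left ((norm_sub_le _ _).trans (add_le_add hq ?_)) hε.1.le
        exact (S.le_opNorm _).trans (by gcongr)
      have h5 : ‖ε • (q - S (K ε h))‖ * |T| ≤ ε * (C * ‖h‖ + ‖S‖ * (C * ‖h‖)) * |T| := by gcongr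
      have h6 := norm_nonneg (K ε h)
      linarith [mul_assoc ε (C * ‖h‖ + ‖S‖ * (C * ‖h‖)) |T|]

end Torus2
end RangeEq

namespace RangeEq

section Assembly

variable {d m : ℕ}

lemma gradient_facts (V : (Fin m → ℝ) → ℝ) (hV : AnalyticOnNhd ℝ V Set.univ)
    (g : (Fin m → ℝ) → (Fin m → ℝ))
    (hg : ∀ x i, g x i = fderiv ℝ V x (Pi.single i 1)) (c : Fin m → ℝ)
    (hhess : (hessianMatrix m V c).PosDef) :
    AnalyticOnNhd ℝ g Set.univ ∧ HasStrictFDerivAt g (mv (hessianMatrix m V c)) c := by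
  let L : ((Fin m → ℝ) →L[ℝ] ℝ) →L[ℝ] (Fin m → ℝ) :=
    ContinuousLinearMap.pi fun i => ContinuousLinearMap.apply ℝ ℝ (Pi.single i 1)
  have hgL : g = fun x => L (fderiv ℝ V x) := by
    funext x i
    rw [hg]
    rfl
  have hdV : AnalyticOnNhd ℝ (fderiv ℝ V) Set.univ := hV.fderiv
  have hga : AnalyticOnNhd ℝ g Set.univ := by
    rw [hgL]
    intro x hx
    exact (L.analyticAt _).comp (hdV x hx)
  refine ⟨hga, ?_⟩
  have h1 : HasStrictFDerivAt g (L.comp (fderiv ℝ (fderiv ℝ V) c)) c := by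
    rw [hgL]
    exact L.hasStrictFDerivAt.comp c (hdV c (Set.mem_univ _)).hasStrictFDerivAt
  have h2 : L.comp (fderiv ℝ (fderiv ℝ V) c) = mv (hessianMatrix m V c) := by
    ext v i
    rw [mv_apply]
    have hsym : ∀ j, hessianMatrix m V c i j = fderiv ℝ (fderiv ℝ V) c (Pi.single j 1) (Pi.single i 1) := by
      intro j
      have := hhess.isHermitian.apply i j
      rw [← this]
      simp [hessianMatrix, iteratedFDeriv_two_apply]
    change fderiv ℝ (fderiv ℝ V) c v (Pi.single i 1) = _
    rw [Matrix.mulVec, dotProduct]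
    simp_rw [hsym]
    conv_lhs => rw [pi_eq_sum_univ' v]
    rw [map_sum, _root_.sum_apply]
    refine Finset.sum_congr rfl fun j _ => ?_
    rw [map_smul, _root_.smul_apply, smul_eq_mul, mul_comm]
  rwa [h2] at h1

lemma fderiv_along (ω ψ : Fin d → ℝ) (W W' : C(UnitAddTorus (Fin d), Fin m → ℝ))
    (hW : HasDerivAt (fun t : ℝ => shift (tproj (t • ω)) W) W' 0)
    (hd : DifferentiableAt ℝ (fun φ => W (tproj φ)) ψ) :
    fderiv ℝ (fun φ => W (tproj φ)) ψ ω = W' (tproj ψ) := by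
  have h1 : HasDerivAt (fun t : ℝ => W (tproj ψ + tproj (t • ω))) (W' (tproj ψ)) 0 :=
    ((ContinuousMap.evalCLM ℝ (tproj ψ) :
      C(UnitAddTorus (Fin d), Fin m → ℝ) →L[ℝ] (Fin m → ℝ)).hasFDerivAt.comp_hasDerivAt 0 hW)
  have h2 : HasDerivAt (fun t : ℝ => ψ + t • ω) ω 0 := by
    simpa using ((hasDerivAt_id (0:ℝ)).smul_const ω).const_add ψ
  have h3 : HasDerivAt (fun t : ℝ => W (tproj (ψ + t • ω)))
      (fderiv ℝ (fun φ => W (tproj φ)) ψ ω) 0 := by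
    have hd' : HasFDerivAt (fun φ => W (tproj φ)) (fderiv ℝ (fun φ => W (tproj φ)) ψ)
        (ψ + (0:ℝ) • ω) := by
      rw [zero_smul, add_zero]; exact hd.hasFDerivAt
    exact hd'.comp_hasDerivAt (0:ℝ) h2
  simp_rw [tproj_add] at h3
  exact h3.unique h1

/-- pull back of a function on the torus to a bounded continuous function. -/
def pull (U : C(UnitAddTorus (Fin d), Fin m → ℝ)) : (Fin d → ℝ) →ᵇ (Fin m → ℝ) :=
  (BoundedContinuousFunction.mkOfCompact U).compContinuous ⟨tproj, tproj_cont⟩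

@[simp] lemma pull_apply (U : C(UnitAddTorus (Fin d), Fin m → ℝ)) (ψ : Fin d → ℝ) :
    pull U ψ = U (tproj ψ) := rfl

lemma pull_cont : Continuous (pull (d := d) (m := m)) := by
  have h : LipschitzWith 1 (pull (d := d) (m := m)) := by
    refine LipschitzWith.of_dist_le_mul fun U W => ?_
    rw [NNReal.coe_one, one_mul, BoundedContinuousFunction.dist_le dist_nonneg]
    intro ψ
    exact ContinuousMap.dist_apply_le_dist (f := U) (g := W) (tproj ψ)
  exact h.continuous

/-- the substitution operator -/
def subst (g : (Fin m → ℝ) → (Fin m → ℝ)) (hg : Continuous g) (c : Fin m → ℝ)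
    (v : C(UnitAddTorus (Fin d), Fin m → ℝ)) : C(UnitAddTorus (Fin d), Fin m → ℝ) :=
  ⟨fun y => g (c + v y), by fun_prop⟩

/-- the nonlinearity -/
def nonlin (g : (Fin m → ℝ) → (Fin m → ℝ)) (hg : Continuous g) (c ζ : Fin m → ℝ)
    (A : (Fin m → ℝ) →L[ℝ] (Fin m → ℝ))
    (v : C(UnitAddTorus (Fin d), Fin m → ℝ)) : C(UnitAddTorus (Fin d), Fin m → ℝ) :=
  subst g hg c (ContinuousMap.const _ ζ + v) - post _ A v

lemma nonlin_apply (g : (Fin m → ℝ) → (Fin m → ℝ)) (hg : Continuous g) (c ζ : Fin m → ℝ)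
    (A : (Fin m → ℝ) →L[ℝ] (Fin m → ℝ))
    (v : C(UnitAddTorus (Fin d), Fin m → ℝ)) (x : UnitAddTorus (Fin d)) :
    nonlin g hg c ζ A v x = g (c + (ζ + v x)) - A (v x) := rfl

end Assembly
end RangeEq

namespace RangeEq

section Assembly2

variable {d m : ℕ}

lemma nonlin_lip (g : (Fin m → ℝ) → (Fin m → ℝ)) (hg : Continuous g) (c ζ : Fin m → ℝ)
    (A : (Fin m → ℝ) →L[ℝ] (Fin m → ℝ)) {ρ δ : ℝ} (hδ : 0 ≤ δ)
    (hA : ∀ x ∈ Metric.ball c (2 * ρ), ∀ y ∈ Metric.ball c (2 * ρ),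
      ‖g x - g y - A (x - y)‖ ≤ δ * ‖x - y‖) (hζ : ‖ζ‖ < ρ) :
    ∀ x ∈ Metric.closedBall (0 : C(UnitAddTorus (Fin d), Fin m → ℝ)) ρ,
      ∀ y ∈ Metric.closedBall (0 : C(UnitAddTorus (Fin d), Fin m → ℝ)) ρ,
      ‖nonlin g hg c ζ A x - nonlin g hg c ζ A y‖ ≤ δ * ‖x - y‖ := by
  intro x hx y hy
  rw [mem_closedBall_zero_iff] at hx hy
  rw [ContinuousMap.norm_le _ (by positivity)]
  intro t
  have key : ∀ z : C(UnitAddTorus (Fin d), Fin m → ℝ), ‖z‖ ≤ ρ →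
      c + (ζ + z t) ∈ Metric.ball c (2 * ρ) := by
    intro z hz
    rw [mem_ball_iff_norm, add_sub_cancel_left]
    have h1 := z.norm_coe_le_norm t
    have h2 := norm_add_le ζ (z t)
    linarith
  have h := hA _ (key x hx) _ (key y hy)
  have e1 : c + (ζ + x t) - (c + (ζ + y t)) = x t - y t := by abel
  rw [e1] at h
  have e2 : (nonlin g hg c ζ A x - nonlin g hg c ζ A y) t
      = g (c + (ζ + x t)) - g (c + (ζ + y t)) - A (x t - y t) := by
    rw [ContinuousMap.sub_apply, nonlin_apply, nonlin_apply, map_sub]; abel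
  rw [e2]
  refine h.trans (mul_le_mul_of_nonneg_left ?_ hδ)
  exact (x - y).norm_coe_le_norm t

lemma nonlin_shift (g : (Fin m → ℝ) → (Fin m → ℝ)) (hg : Continuous g) (c ζ : Fin m → ℝ)
    (A : (Fin m → ℝ) →L[ℝ] (Fin m → ℝ)) (θ : UnitAddTorus (Fin d))
    (U : C(UnitAddTorus (Fin d), Fin m → ℝ)) :
    nonlin g hg c ζ A (shift θ U) = shift θ (nonlin g hg c ζ A U) := by
  refine ContinuousMap.ext fun x => ?_
  rw [shift_apply, nonlin_apply, nonlin_apply, shift_apply]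

lemma nonlin_analytic (g : (Fin m → ℝ) → (Fin m → ℝ)) (hg : Continuous g) (c ζ : Fin m → ℝ)
    (A : (Fin m → ℝ) →L[ℝ] (Fin m → ℝ)) {r ρ : ℝ} (hr : 2 * ρ ≤ r)
    (hN : ∀ v : C(UnitAddTorus (Fin d), Fin m → ℝ), ‖v‖ < r → AnalyticAt ℝ (subst g hg c) v)
    (hζ : ‖ζ‖ < ρ) (U : C(UnitAddTorus (Fin d), Fin m → ℝ)) (hU : ‖U‖ < ρ) :
    AnalyticAt ℝ (nonlin g hg c ζ A) U := by
  have h0 : ‖ContinuousMap.const (UnitAddTorus (Fin d)) ζ‖ ≤ ‖ζ‖ := by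
    rw [ContinuousMap.norm_le _ (norm_nonneg _)]
    intro x
    rfl
  have h1 : ‖ContinuousMap.const (UnitAddTorus (Fin d)) ζ + U‖ < r :=
    (norm_add_le _ _).trans_lt (by linarith)
  have h2 : AnalyticAt ℝ (fun v : C(UnitAddTorus (Fin d), Fin m → ℝ) =>
      ContinuousMap.const (UnitAddTorus (Fin d)) ζ + v) U := analyticAt_const.add analyticAt_id
  have h3 := AnalyticAt.comp (g := subst g hg c) (x := U) (hN _ h1) h2
  exact h3.sub ((post (UnitAddTorus (Fin d)) A).analyticAt U)

lemma mean_proj0 (h : C(UnitAddTorus (Fin d), Fin m → ℝ)) :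
    meanOp d (Fin m → ℝ) (proj0 d (Fin m → ℝ) h) = 0 := by
  rw [proj0_apply, map_sub, meanOp_idem, sub_self]

lemma proj0_const (e : Fin m → ℝ) :
    proj0 d (Fin m → ℝ) (ContinuousMap.const _ e) = 0 := by
  rw [proj0_apply, meanOp_const, sub_self]

lemma proj0_shift (θ : UnitAddTorus (Fin d)) (h : C(UnitAddTorus (Fin d), Fin m → ℝ)) :
    proj0 d (Fin m → ℝ) (shift θ h) = shift θ (proj0 d (Fin m → ℝ) h) := by
  rw [proj0_apply, proj0_apply, map_sub]
  congr 1
  exact DFunLike.congr_fun (meanOp_shift (d := d) (E := Fin m → ℝ) θ).eq h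

lemma nonlin_zero (g : (Fin m → ℝ) → (Fin m → ℝ)) (hg : Continuous g) (c ζ : Fin m → ℝ)
    (A : (Fin m → ℝ) →L[ℝ] (Fin m → ℝ)) :
    nonlin g hg c ζ A (0 : C(UnitAddTorus (Fin d), Fin m → ℝ))
      = ContinuousMap.const _ (g (c + ζ)) := by
  refine ContinuousMap.ext fun x => ?_
  rw [nonlin_apply]
  simp

/-- If shifts of `U` are analytic at the origin then the pull back is analytic. -/
lemma pull_analytic (U : C(UnitAddTorus (Fin d), Fin m → ℝ))
    (h : AnalyticAt ℝ (fun φ : Fin d → ℝ => shift (tproj φ) U) 0) :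
    AnalyticOnNhd ℝ (fun ψ => U (tproj ψ)) Set.univ := by
  intro ψ₀ _
  have h1 : AnalyticAt ℝ (fun ψ : Fin d → ℝ => ψ - ψ₀) ψ₀ := analyticAt_id.sub analyticAt_const
  have h2 : AnalyticAt ℝ (fun ψ : Fin d → ℝ => shift (tproj (ψ - ψ₀)) U) ψ₀ :=
    AnalyticAt.comp_of_eq (g := fun φ : Fin d → ℝ => shift (tproj φ) U) h h1 (sub_self _)
  have h3 := ((ContinuousMap.evalCLM ℝ (tproj ψ₀) :
      C(UnitAddTorus (Fin d), Fin m → ℝ) →L[ℝ] (Fin m → ℝ)).analyticAt _).comp h2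
  refine h3.congr (Eventually.of_forall fun ψ => ?_)
  change (shift (tproj (ψ - ψ₀)) U) (tproj ψ₀) = U (tproj ψ)
  rw [shift_apply, ← tproj_add, add_sub_cancel]

/-- The differential equation on the torus gives the range equation. -/
lemma equation_of_torus (ω : Fin d → ℝ) (Γ A : Matrix (Fin m) (Fin m) ℝ)
    (hdet : IsUnit Γ.det) (g : (Fin m → ℝ) → (Fin m → ℝ)) (hg : Continuous g)
    (c ζ : Fin m → ℝ) (ε : ℝ) (f : (Fin d → ℝ) → (Fin m → ℝ))
    (F U q : C(UnitAddTorus (Fin d), Fin m → ℝ)) (hF : ∀ ψ, F (tproj ψ) = f ψ)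
    (hUan : AnalyticOnNhd ℝ (fun ψ => U (tproj ψ)) Set.univ)
    (hU0 : meanOp d (Fin m → ℝ) U = 0)
    (h1 : HasDerivAt (fun t : ℝ => shift (tproj (t • ω)) U)
      (ε • (q - post _ (mv (Γ⁻¹ * A)) U)) 0)
    (h2 : HasDerivAt (fun t : ℝ => shift (tproj (t • ω)) (ε • (q - post _ (mv (Γ⁻¹ * A)) U)))
      (proj0 d (Fin m → ℝ) (F - nonlin g hg c ζ (mv A) U) - post _ (mv Γ) q) 0)
    (ψ : Fin d → ℝ) :
    ε • fderiv ℝ (fun φ : Fin d → ℝ => fderiv ℝ (fun ψ => U (tproj ψ)) φ ω) ψ ω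
      + Γ.mulVec (fderiv ℝ (fun ψ => U (tproj ψ)) ψ ω)
      + ε • (g (c + ζ + U (tproj ψ)) - boxMean d m fun φ => g (c + ζ + U (tproj φ)))
      = ε • (f ψ - boxMean d m f) := by
  set W := ε • (q - post (UnitAddTorus (Fin d)) (mv (Γ⁻¹ * A)) U) with hW
  have e1 : (fun φ : Fin d → ℝ => fderiv ℝ (fun ψ => U (tproj ψ)) φ ω)
      = fun φ => W (tproj φ) := by
    funext φ
    exact fderiv_along ω φ U W h1 (hUan φ (Set.mem_univ _)).differentiableAt
  have hWan : DifferentiableAt ℝ (fun φ : Fin d → ℝ => W (tproj φ)) ψ := by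
    rw [← e1]
    have := (hUan.fderiv ψ (Set.mem_univ _)).differentiableAt
    exact this.clm_apply (differentiableAt_const _)
  have e2 := fderiv_along ω ψ W _ h2 hWan
  have e3 := congrFun e1 ψ
  rw [e1, e2, e3]
  set N := subst g hg c (ContinuousMap.const _ ζ + U) with hNdef
  have hN : ∀ x, N x = g (c + ζ + U x) := by
    intro x
    rw [add_assoc]; rfl
  have m1 : boxMean d m f = ∫ x, F x ∂(haarT d) := by
    rw [← boxMean_tproj]
    congr 1
    funext φ
    rw [hF]
  have m2 : (boxMean d m fun φ => g (c + ζ + U (tproj φ))) = ∫ x, N x ∂(haarT d) := by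
    rw [← boxMean_tproj]
    congr 1
    funext φ
    rw [hN]
  have m3 : meanOp d (Fin m → ℝ) (post _ (mv A) U) = 0 := by
    have := DFunLike.congr_fun (meanOp_post (d := d) (mv A)).eq U
    change meanOp d (Fin m → ℝ) (post _ (mv A) U) = post _ (mv A) (meanOp d (Fin m → ℝ) U) at this
    rw [this, hU0, map_zero]
  have p1 : proj0 d (Fin m → ℝ) (F - nonlin g hg c ζ (mv A) U)
      = F - meanOp d (Fin m → ℝ) F - (N - meanOp d (Fin m → ℝ) N) + post _ (mv A) U := by
    have : nonlin g hg c ζ (mv A) U = N - post _ (mv A) U := rfl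
    rw [this, proj0_apply, map_sub, map_sub, m3]
    abel
  rw [p1, m1, m2, ← hN, ← hF ψ]
  have v1 : W (tproj ψ) = ε • (q (tproj ψ) - (Γ⁻¹ * A).mulVec (U (tproj ψ))) := by
    rw [hW, ContinuousMap.smul_apply, ContinuousMap.sub_apply, post_apply, mv_apply]
  rw [v1, Matrix.mulVec_smul, Matrix.mulVec_sub, Matrix.mulVec_mulVec, ← Matrix.mul_assoc,
    Matrix.mul_nonsing_inv _ hdet, Matrix.one_mul]
  simp only [ContinuousMap.sub_apply, ContinuousMap.add_apply, post_apply, mv_apply, meanOp_apply]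
  module

end Assembly2
end RangeEq

open RangeEq

theorem range_equation_solution_continuous_in_eps
    (m d : ℕ) (hm : 1 ≤ m) (hd : 1 ≤ d)
    (ω : Fin d → ℝ) (hω : ∀ ν : Fin d → ℤ, ν ≠ 0 → (∑ j, ω j * ν j) ≠ 0)
    (Γ : Matrix (Fin m) (Fin m) ℝ) (hΓsymm : Γ.IsSymm) (hΓpos : Γ.PosDef)
    (V : (Fin m → ℝ) → ℝ) (hV : AnalyticOnNhd ℝ V Set.univ)
    (g : (Fin m → ℝ) → (Fin m → ℝ))
    (hg : ∀ x i, g x i = fderiv ℝ V x (Pi.single i 1))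
    (f : (Fin d → ℝ) → (Fin m → ℝ))
    (hfper : IsPeriodic2pi d m f) (hfan : AnalyticOnNhd ℝ f Set.univ)
    (c : Fin m → ℝ) (hc : g c = boxMean d m f)
    (hhess : (hessianMatrix m V c).PosDef) :
    ∃ εbar > (0 : ℝ), ∃ ζbar > (0 : ℝ),
      ∃ u : ℝ → (Fin m → ℝ) → ((Fin d → ℝ) →ᵇ (Fin m → ℝ)),
        (∀ ε ∈ Set.Ioo (0 : ℝ) εbar, ∀ ζ : Fin m → ℝ, ‖ζ‖ < ζbar →
          AnalyticOnNhd ℝ (u ε ζ : (Fin d → ℝ) → (Fin m → ℝ)) Set.univ ∧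
          IsPeriodic2pi d m (u ε ζ) ∧
          boxMean d m (u ε ζ) = 0 ∧
          ∀ ψ : Fin d → ℝ,
            ε • fderiv ℝ (fun φ : Fin d → ℝ => fderiv ℝ (u ε ζ) φ ω) ψ ω
              + Γ.mulVec (fderiv ℝ (u ε ζ : (Fin d → ℝ) → (Fin m → ℝ)) ψ ω)
              + ε • (g (c + ζ + u ε ζ ψ) - boxMean d m fun φ => g (c + ζ + u ε ζ φ))
            = ε • (f ψ - boxMean d m f)) ∧
        (∀ ζ : Fin m → ℝ, ‖ζ‖ < ζbar →
          u 0 ζ = 0 ∧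
          ContinuousOn (fun ε : ℝ => u ε ζ) (Set.Ico 0 εbar) ∧
          Tendsto (fun ε : ℝ => ⨆ ψ : Fin d → ℝ, ‖u ε ζ ψ‖)
            (nhdsWithin 0 (Set.Ioi 0)) (nhds 0)) := by
  set A := hessianMatrix m V c with hA
  obtain ⟨hga, hgd⟩ := gradient_facts V hV g hg c hhess
  have hgc : Continuous g := by
    rw [← continuousOn_univ]
    exact hga.continuousOn
  have hdet : IsUnit Γ.det := hΓpos.det_pos.ne'.isUnit
  obtain ⟨C₁, α₁, hG⟩ := matrix_decay (G := 1) (M := Γ) Matrix.PosDef.one (by simpa using hΓpos)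
  obtain ⟨C₂, α₂, hS⟩ := matrix_decay (G := Γ) (M := Γ⁻¹ * A) hΓpos (by
    rw [← Matrix.mul_assoc, Matrix.mul_nonsing_inv _ hdet, Matrix.one_mul]; exact hhess)
  obtain ⟨ε₀, hε₀, C, hC, K, hKb, hKcomm, hKc, hKd⟩ :=
    exists_solution_operator (shift_flow (d := d) (E := Fin m → ℝ) ω)
      (post_decays (Y := UnitAddTorus (Fin d)) hG) (post_decays (Y := UnitAddTorus (Fin d)) hS)
      (fun t => shift_post _ _) (fun t => shift_post _ _)
  have hKs : ∀ ε ∈ Set.Ioo 0 ε₀, ∀ θ, Commute (shift θ) (K ε) := fun ε hε θ =>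
    hKcomm ε hε _ (shift_post _ _).symm (shift_post _ _).symm (fun t => shift_shift _ _)
  have hKm : ∀ ε ∈ Set.Ioo 0 ε₀, Commute (meanOp d (Fin m → ℝ)) (K ε) := fun ε hε =>
    hKcomm ε hε _ (meanOp_post _) (meanOp_post _) (fun t => meanOp_shift _)
  have hfc : Continuous f := by
    rw [← continuousOn_univ]
    exact hfan.continuousOn
  obtain ⟨F, hF⟩ := exists_descend f hfc hfper
  have hlim := fun h => averaged_tendsto ω hω hε₀ K (post _ (mv (Γ⁻¹ * A))) hKb hKs
    (fun ε hε x => by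
      obtain ⟨q, h1, h2, h3⟩ := hKd ε hε x
      exact ⟨q, h1, h2⟩) h
  set P := proj0 d (Fin m → ℝ) with hP
  set L : ℝ → C(UnitAddTorus (Fin d), Fin m → ℝ) →L[ℝ] C(UnitAddTorus (Fin d), Fin m → ℝ) :=
    fun ε => (K ε).comp P with hL
  set C' := C * ‖P‖ with hC'
  have hC'0 : 0 ≤ C' := by positivity
  have hLb : ∀ ε ∈ Set.Ioo 0 ε₀, ‖L ε‖ ≤ C' := fun ε hε =>
    (ContinuousLinearMap.opNorm_comp_le _ _).trans
      (mul_le_mul_of_nonneg_right (hKb ε hε) (norm_nonneg _))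
  set δ : ℝ := 1 / (2 * (C' + 1)) with hδdef
  have hδ : 0 < δ := by positivity
  have hCδ : C' * δ ≤ 1 / 2 := by
    rw [hδdef, mul_one_div, div_le_div_iff₀ (by positivity) (by norm_num)]
    linarith
  obtain ⟨s, hs, hsA⟩ := hgd.approximates_deriv_on_nhds (c := ⟨δ, hδ.le⟩) (Or.inr hδ)
  obtain ⟨R, hR, hRs⟩ := Metric.mem_nhds_iff.1 hs
  obtain ⟨r, hr, hNan⟩ := nemytskii_analytic (Y := UnitAddTorus (Fin d))
    (hga c (Set.mem_univ _)) hgc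
  set ρ := min R r / 2 with hρdef
  have hρ : 0 < ρ := by
    have := lt_min hR hr
    positivity
  have h2R : 2 * ρ ≤ R := by
    have := min_le_left R r
    rw [hρdef]; linarith
  have h2r : 2 * ρ ≤ r := by
    have := min_le_right R r
    rw [hρdef]; linarith
  have hApp : ∀ x ∈ Metric.ball c (2 * ρ), ∀ y ∈ Metric.ball c (2 * ρ),
      ‖g x - g y - mv A (x - y)‖ ≤ δ * ‖x - y‖ := fun x hx y hy =>
    hsA x (hRs (Metric.ball_subset_ball h2R hx)) y (hRs (Metric.ball_subset_ball h2R hy))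
  have hlimF : Tendsto (fun ε => L ε F) (nhdsWithin 0 (Set.Ioi 0)) (nhds 0) := hlim F
  have hev : ∀ᶠ ε in nhdsWithin (0 : ℝ) (Set.Ioi 0), ‖L ε F‖ ≤ ρ / 4 := by
    have h4 : (0 : ℝ) < ρ / 4 := by positivity
    filter_upwards [hlimF.eventually (Metric.closedBall_mem_nhds _ h4)] with ε hε
    simpa using hε
  obtain ⟨ε₁, hε₁, hε₁s⟩ := mem_nhdsGT_iff_exists_Ioo_subset.1 hev
  have hε₁' : 0 < ε₁ := hε₁
  set εb := min ε₀ ε₁ with hεb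
  have hεb0 : 0 < εb := lt_min hε₀ hε₁'
  have hsub : ∀ ε ∈ Set.Ioo 0 εb, ε ∈ Set.Ioo 0 ε₀ := fun ε hε =>
    ⟨hε.1, hε.2.trans_le (min_le_left _ _)⟩
  have hLF : ∀ ε ∈ Set.Ioo 0 εb, ‖L ε F‖ ≤ ρ / 4 := fun ε hε =>
    hε₁s ⟨hε.1, hε.2.trans_le (min_le_right _ _)⟩
  have hfam : ∀ ζ : Fin m → ℝ, ∃ U : ℝ → C(UnitAddTorus (Fin d), Fin m → ℝ), ‖ζ‖ < ρ →
      U 0 = 0 ∧ (∀ ε ∈ Set.Ioo 0 εb, ‖U ε‖ < ρ ∧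
        U ε = L ε (F - nonlin g hgc c ζ (mv A) (U ε))) ∧ ContinuousOn U (Set.Ico 0 εb) := by
    intro ζ
    by_cases hζ : ‖ζ‖ < ρ
    · obtain ⟨U, hU⟩ := fixed_point_family L hρ hδ.le hCδ hLb
        (fun x => hKc (P x)) (nonlin g hgc c ζ (mv A)) F
        (nonlin_lip g hgc c ζ (mv A) hδ.le hApp hζ)
        (fun ε _ => by
          rw [nonlin_zero]
          change K ε (P _) = 0
          rw [hP, proj0_const, map_zero])
        (min_le_left ε₀ ε₁) hLF hlimF
      exact ⟨U, fun _ => hU⟩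
    · exact ⟨0, fun h => absurd h hζ⟩
  choose U hU using hfam
  refine ⟨εb, hεb0, ρ, hρ, fun ε ζ => pull (U ζ ε), ?_, ?_⟩
  · intro ε hε ζ hζ
    obtain ⟨-, hUfix, -⟩ := hU ζ hζ
    obtain ⟨hUρ, hUeq⟩ := hUfix ε hε
    have hε0 := hsub ε hε
    have hLs : ∀ θ x, L ε (shift θ x) = shift θ (L ε x) := by
      intro θ x
      change K ε (P (shift θ x)) = shift θ (K ε (P x))
      rw [hP, proj0_shift]
      exact (DFunLike.congr_fun (hKs ε hε0 θ).eq (P x)).symm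
    have hw : AnalyticAt ℝ (fun φ : Fin d → ℝ => shift (tproj φ) (U ζ ε)) 0 := by
      refine analytic_of_implicit (L ε) hδ.le (hLb ε hε0) hCδ (nonlin g hgc c ζ (mv A))
        (nonlin_lip g hgc c ζ (mv A) hδ.le hApp hζ) hUρ
        (nonlin_analytic g hgc c ζ (mv A) h2r hNan hζ _ hUρ) _
        (fun φ => L ε (shift (tproj φ) F)) 0 ?_ ?_ ?_ ?_
      · refine ContinuousMap.ext fun x => ?_
        rw [shift_apply, tproj_zero, add_zero]
      · exact ((shift_cont (U ζ ε)).comp tproj_cont).continuousAt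
      · exact ((L ε).analyticAt _).comp (shift_analytic f hfan hfper F hF)
      · intro φ
        rw [nonlin_shift, hLs, hLs, ← map_add]
        congr 1
        nth_rewrite 1 [hUeq]
        rw [map_sub, sub_add_cancel]
    have hUan := pull_analytic _ hw
    have hU0 : meanOp d (Fin m → ℝ) (U ζ ε) = 0 := by
      rw [hUeq]
      have := DFunLike.congr_fun (hKm ε hε0).eq (P (F - nonlin g hgc c ζ (mv A) (U ζ ε)))
      change meanOp d (Fin m → ℝ) (K ε (P _)) = K ε (meanOp d (Fin m → ℝ) (P _)) at this
      change meanOp d (Fin m → ℝ) (K ε (P _)) = 0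
      rw [this, hP, mean_proj0, map_zero]
    refine ⟨hUan, ?_, ?_, ?_⟩
    · intro ψ k
      rw [pull_apply, pull_apply, tproj_periodic]
    · have h1 := boxMean_tproj (U ζ ε)
      have h2 := DFunLike.congr_fun hU0 0
      rw [meanOp_apply] at h2
      rw [h2] at h1
      exact h1
    · obtain ⟨q, -, hq1, hq2⟩ := hKd ε hε0 (P (F - nonlin g hgc c ζ (mv A) (U ζ ε)))
      have hUeq' : K ε (P (F - nonlin g hgc c ζ (mv A) (U ζ ε))) = U ζ ε := hUeq.symm
      rw [hUeq'] at hq1 hq2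
      exact equation_of_torus ω Γ A hdet g hgc c ζ ε f F (U ζ ε) q hF hUan hU0 hq1 hq2
  · intro ζ hζ
    obtain ⟨hU0, -, hUc⟩ := hU ζ hζ
    have hz : pull (U ζ 0) = 0 := by
      rw [hU0]; rfl
    have hc' : ContinuousOn (fun ε : ℝ => pull (U ζ ε)) (Set.Ico 0 εb) :=
      pull_cont.comp_continuousOn hUc
    refine ⟨hz, hc', ?_⟩
    have h1 : Tendsto (fun ε : ℝ => pull (U ζ ε)) (nhdsWithin 0 (Set.Ioi 0)) (nhds 0) := by
      have h2 := hc' 0 ⟨le_rfl, hεb0⟩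
      rw [ContinuousWithinAt, hz] at h2
      refine h2.mono_left ?_
      rw [nhdsWithin_le_iff]
      exact mem_of_superset (Ioo_mem_nhdsGT hεb0) Set.Ioo_subset_Ico_self
    have h3 := h1.norm
    rw [norm_zero] at h3
    refine h3.congr fun ε => ?_
    exact BoundedContinuousFunction.norm_eq_iSup_norm _

end
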